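/- arXiv:2509.09814 — 2 statements merged into one kernel-verified Lean document; each statement's English description precedes it below -/
import Mathlib

section
/- Fix θ > 0. For the Jack–Plancherel measure M^{(n)}_θ on partitions of n, for every n ≥ 1 and every m ∈ {1,…,n}, the probability that λ₁ = m is at most θ^{−1}·(e²nθ/m²)^m. -/
open Finset

/-- `λ'_{j+1} = #{i < n : λᵢ > j}`, the conjugate partition of `f` (valid when `f` is a
partition of `n`, since then it has at most `n` parts). -/
def jpConj (n : ℕ) (f : ℕ → ℕ) (j : ℕ) : ℕ := ((Finset.range n).filter (fun i => j < f i)).card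

/-- The Jack–Plancherel weight
`M^{(n)}_θ(λ) = n!·θⁿ / ∏_{i=1}^{ℓ(λ)} ∏_{j=1}^{λᵢ}
  [(λᵢ − j + θ(λ'ⱼ − i) + θ)(λᵢ − j + θ(λ'ⱼ − i) + 1)]`
of a partition `λ` of `n` (given by its 0-indexed parts `f 0 ≥ f 1 ≥ ⋯`; all products may be
taken over indices `< n` since a partition of `n` has at most `n` parts, all of size `≤ n`). -/
noncomputable def jackPlancherelWeight (θ : ℝ) (n : ℕ) (f : ℕ → ℕ) : ℝ :=
  (Nat.factorial n : ℝ) * θ ^ n /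
    ∏ i ∈ Finset.range n, ∏ j ∈ Finset.range (f i),
      ((((f i : ℝ) - j - 1) + θ * ((jpConj n f j : ℝ) - i - 1) + θ) *
        (((f i : ℝ) - j - 1) + θ * ((jpConj n f j : ℝ) - i - 1) + 1))

/-- The content `λᵢ − θ i` of the cell just after the end of row `i` (rows are 0-indexed). -/
noncomputable def jackContent (θ : ℝ) (f : ℕ → ℕ) (i : ℕ) : ℝ := f i - θ * i

/-- The probability that the Jack–Plancherel growth process adds a cell in row `k` to a partition
with at most `N` parts. -/
noncomputable def jackUpRate (θ : ℝ) (N : ℕ) (f : ℕ → ℕ) (k : ℕ) : ℝ :=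
  (∏ i ∈ range N, (jackContent θ f k - (jackContent θ f i - θ))) /
    ∏ i ∈ range (N + 1), if i = k then 1 else jackContent θ f k - jackContent θ f i

/-- The unnormalised rate at which the reversed growth process removes a cell from row `k`. -/
noncomputable def jackDownRate (θ : ℝ) (N : ℕ) (f : ℕ → ℕ) (k : ℕ) : ℝ :=
  -(∏ i ∈ range (N + 1), (jackContent θ f k - θ - jackContent θ f i)) /
    ∏ i ∈ range N, if i = k then 1 else jackContent θ f k - jackContent θ f i

/-- The two hook lengths of a cell in column `j` of a row of length `r`, multiplied together, where
`c` counts the cells of the column from this row downwards. -/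
noncomputable def jackCellFactor (θ r j c : ℝ) : ℝ :=
  (r - j - 1 + θ * (c - 1) + θ) * (r - j - 1 + θ * (c - 1) + 1)

/-- The product of the hook lengths of all cells. -/
noncomputable def jackHookProd (θ : ℝ) (N : ℕ) (f : ℕ → ℕ) : ℝ :=
  ∏ i ∈ range N, ∏ j ∈ range (f i), jackCellFactor θ (f i) j ((jpConj N f j : ℝ) - i)

/-- The product of the hook lengths of the cells of the first row. -/
noncomputable def jackFirstRow (θ : ℝ) (N : ℕ) (f : ℕ → ℕ) : ℝ :=
  ∏ j ∈ range (f 0), jackCellFactor θ (f 0) j (jpConj N f j)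

lemma prod_erase_eq_prod_ite {s : Finset ℕ} {k : ℕ} (hk : k ∈ s) (F : ℕ → ℝ) :
    ∏ i ∈ s.erase k, F i = ∏ i ∈ s, if i = k then 1 else F i := by
  rw [← Finset.mul_prod_erase s _ hk, if_pos rfl, one_mul]
  exact Finset.prod_congr rfl fun i hi => (if_neg (Finset.ne_of_mem_erase hi)).symm

lemma jackContent_strictAnti {θ : ℝ} (hθ : 0 < θ) {f : ℕ → ℕ} (hf : Antitone f) :
    StrictAnti (jackContent θ f) := by
  intro i j hij
  have h1 : (f j : ℝ) ≤ f i := by exact_mod_cast hf hij.le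
  have h2 : (i : ℝ) < j := by exact_mod_cast hij
  unfold jackContent
  nlinarith

open Polynomial in
lemma coeff_prod_X_sub_C (x : ℕ → ℝ) (n : ℕ) :
    (∏ i ∈ range n, (X - C (x i))).coeff n = 1 ∧
    (X * ∏ i ∈ range n, (X - C (x i))).coeff n = -∑ i ∈ range n, x i ∧
    (X ^ 2 * ∏ i ∈ range n, (X - C (x i))).coeff n =
      ((∑ i ∈ range n, x i) ^ 2 - ∑ i ∈ range n, x i ^ 2) / 2 := by
  induction n with
  | zero => simp
  | succ n ih =>
    obtain ⟨h0, h1, h2⟩ := ih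
    set P := ∏ i ∈ range n, (X - C (x i)) with hP
    have hdeg : P.coeff (n + 1) = 0 := by
      apply coeff_eq_zero_of_natDegree_lt
      rw [hP, natDegree_finsetProd_X_sub_C_eq_card]
      simp
    have h1' : (X * P).coeff (n + 1) = 1 := by rw [coeff_X_mul, h0]
    have h2' : (X ^ 2 * P).coeff (n + 1) = -∑ i ∈ range n, x i := by
      rw [pow_two, mul_assoc, coeff_X_mul, h1]
    rw [Finset.prod_range_succ, ← hP, Finset.sum_range_succ, Finset.sum_range_succ]
    refine ⟨?_, ?_, ?_⟩
    · rw [mul_sub, coeff_sub, coeff_mul_X, coeff_mul_C, h0, hdeg]; ring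
    · rw [← mul_assoc, mul_sub, coeff_sub, coeff_mul_X, coeff_mul_C, h1, h1']; ring
    · rw [← mul_assoc, mul_sub, coeff_sub, coeff_mul_X, coeff_mul_C, h2, h2']; ring

open Polynomial in
lemma sum_jackUpRate {θ : ℝ} (hθ : 0 < θ) (N : ℕ) {f : ℕ → ℕ} (hf : Antitone f) :
    ∑ k ∈ range (N + 1), jackUpRate θ N f k = 1 := by
  have hinj : Set.InjOn (jackContent θ f) (range (N + 1)) :=
    (jackContent_strictAnti hθ hf).injective.injOn
  have hnat : (∏ i ∈ range N, (X - C (jackContent θ f i - θ))).natDegree = N := by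
    rw [natDegree_finsetProd_X_sub_C_eq_card, card_range]
  have hdeg : (∏ i ∈ range N, (X - C (jackContent θ f i - θ))).degree < ((#(range (N + 1)) : ℕ) : WithBot ℕ) := by
    refine degree_le_natDegree.trans_lt ?_
    rw [hnat, card_range]
    exact_mod_cast N.lt_succ_self
  have h := Lagrange.coeff_eq_sum hinj hdeg
  rw [card_range, Nat.add_sub_cancel, (coeff_prod_X_sub_C _ N).1] at h
  rw [h]
  refine Finset.sum_congr rfl fun k hk => ?_
  rw [jackUpRate, prod_erase_eq_prod_ite hk, eval_prod]
  simp

open Polynomial in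
lemma sum_jackDownRate {θ : ℝ} (hθ : 0 < θ) (N : ℕ) {f : ℕ → ℕ} (hf : Antitone f)
    (hN : f N = 0) :
    ∑ k ∈ range N, jackDownRate θ N f k = θ * ∑ i ∈ range N, (f i : ℝ) := by
  obtain _ | M := N
  · simp
  set x := jackContent θ f with hx
  set y : ℕ → ℝ := fun i => x i - θ with hy
  have hinj : Set.InjOn y (range (M + 1)) := by
    intro i _ j _ hij
    exact (jackContent_strictAnti hθ hf).injective (sub_left_injective hij)
  set A : ℝ[X] := ∏ i ∈ range (M + 2), (X - C (x i)) with hA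
  set B : ℝ[X] := ∏ i ∈ range (M + 1), (X - C (y i)) with hB
  obtain ⟨a0, a1, a2⟩ := coeff_prod_X_sub_C x (M + 2)
  obtain ⟨b0, b1, b2⟩ := coeff_prod_X_sub_C y (M + 1)
  rw [← hA] at a0 a1 a2
  rw [← hB] at b0 b1 b2
  have hAd : A.natDegree = M + 2 := by
    rw [hA, natDegree_finsetProd_X_sub_C_eq_card, card_range]
  have hBd : B.natDegree = M + 1 := by
    rw [hB, natDegree_finsetProd_X_sub_C_eq_card, card_range]
  have hxM : x (M + 1) = -θ * (M + 1) := by simp [hx, jackContent, hN]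
  have hs1 : ∀ n : ℕ, ∑ i ∈ range n, y i = ∑ i ∈ range n, x i - θ * n := by
    intro n; simp [hy, mul_comm]
  have hs2 : ∀ n : ℕ, ∑ i ∈ range n, x i ^ 2 - ∑ i ∈ range n, y i ^ 2 =
      2 * θ * ∑ i ∈ range n, (f i : ℝ) - θ ^ 2 * n ^ 2 := by
    intro n
    induction n with
    | zero => simp
    | succ n ih =>
      simp only [Finset.sum_range_succ, hy, hx, jackContent] at ih ⊢
      push_cast
      linear_combination ih
  have hdeg : (A - X * B).degree < ((#(range (M + 1)) : ℕ) : WithBot ℕ) := by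
    rw [card_range, degree_lt_iff_coeff_zero]
    intro m hm
    obtain rfl | hm := hm.eq_or_lt
    · rw [coeff_sub, b1, ← coeff_X_mul, a1, Finset.sum_range_succ, hs1, hxM]
      push_cast
      ring
    obtain rfl | hm := (Nat.succ_le_of_lt hm).eq_or_lt
    · rw [coeff_sub, a0, coeff_X_mul, b0, sub_self]
    · rw [coeff_sub, coeff_eq_zero_of_natDegree_lt (by omega), coeff_eq_zero_of_natDegree_lt,
        sub_zero]
      refine natDegree_mul_le.trans_lt ?_
      rw [natDegree_X]
      omega
  have h := Lagrange.coeff_eq_sum hinj hdeg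
  have hc : (A - X * B).coeff M = -(θ * ∑ i ∈ range (M + 1), (f i : ℝ)) := by
    rw [coeff_sub, ← coeff_X_mul A, ← coeff_X_mul (X * A), ← coeff_X_mul (X * B), ← mul_assoc,
      ← mul_assoc, ← pow_two, a2, b2, Finset.sum_range_succ x, Finset.sum_range_succ (fun i => x i ^ 2),
      hs1, hxM]
    have := hs2 (M + 1)
    push_cast at this ⊢
    linear_combination -this / 2
  rw [card_range, Nat.add_sub_cancel, hc] at h
  rw [← neg_inj, h, ← Finset.sum_neg_distrib]
  refine Finset.sum_congr rfl fun k hk => ?_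
  have hBk : B.eval (y k) = 0 := by
    rw [hB, eval_prod]
    exact Finset.prod_eq_zero hk (by simp)
  rw [jackDownRate, prod_erase_eq_prod_ite hk, eval_sub, eval_mul, hBk, mul_zero, sub_zero, hA,
    eval_prod]
  simp [hy, hx, neg_div]

lemma jackUpRate_eq_zero {θ : ℝ} {N k : ℕ} {f : ℕ → ℕ} (hk : k + 1 ≤ N) (h : f k = f (k + 1)) :
    jackUpRate θ N f (k + 1) = 0 := by
  rw [jackUpRate, Finset.prod_eq_zero (Finset.mem_range.2 hk), zero_div]
  simp only [jackContent, h]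
  push_cast
  ring

lemma jackDownRate_eq_zero {θ : ℝ} {N k : ℕ} {f : ℕ → ℕ} (hk : k < N) (h : f k = f (k + 1)) :
    jackDownRate θ N f k = 0 := by
  rw [jackDownRate, Finset.prod_eq_zero (Finset.mem_range.2 (Nat.succ_lt_succ hk)), neg_zero,
    zero_div]
  simp only [jackContent, h]
  push_cast
  ring

lemma jpConj_succ {N j : ℕ} {f : ℕ → ℕ} (hj : j < f 0) :
    jpConj (N + 1) f j = jpConj N (fun i => f (i + 1)) j + 1 := by
  simp only [jpConj, Finset.card_filter, Finset.sum_range_succ', hj, if_true]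

lemma jpConj_eq {N j c : ℕ} {f : ℕ → ℕ} (hc : c ≤ N) (h : ∀ i < N, j < f i ↔ i < c) :
    jpConj N f j = c := by
  have : (range N).filter (fun i => j < f i) = range c := by
    ext i
    simp only [Finset.mem_filter, Finset.mem_range]
    exact ⟨fun hi => (h i hi.1).1 hi.2, fun hi => ⟨hi.trans_le hc, (h i (hi.trans_le hc)).2 hi⟩⟩
  rw [jpConj, this, card_range]

lemma jackHookProd_succ (θ : ℝ) (N : ℕ) {f : ℕ → ℕ} (hf : Antitone f) :
    jackHookProd θ (N + 1) f =
      jackFirstRow θ (N + 1) f * jackHookProd θ N (fun i => f (i + 1)) := by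
  rw [jackHookProd, Finset.prod_range_succ', mul_comm, jackFirstRow, jackHookProd]
  congr 1
  · simp
  · refine Finset.prod_congr rfl fun i _ => Finset.prod_congr rfl fun j hj => ?_
    rw [jpConj_succ ((Finset.mem_range.1 hj).trans_le (hf (Nat.zero_le _)))]
    push_cast
    congr 1
    ring

lemma prod_jpConj {M : ℕ} {f : ℕ → ℕ} (hf : Antitone f) (hM : f M = 0) (F : ℕ → ℕ → ℝ) :
    ∏ j ∈ range (f 0), F j (jpConj M f j) =
      ∏ i ∈ range M, ∏ j ∈ Ico (f (i + 1)) (f i), F j (i + 1) := by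
  have key : ∀ m ≤ M, ∏ j ∈ Ico (f m) (f 0), F j (jpConj M f j) =
      ∏ i ∈ range m, ∏ j ∈ Ico (f (i + 1)) (f i), F j (i + 1) := by
    intro m
    induction m with
    | zero => simp
    | succ m ih =>
      intro hm
      rw [Finset.prod_range_succ, ← ih (by omega), mul_comm,
        ← Finset.prod_Ico_consecutive _ (hf m.le_succ) (hf m.zero_le)]
      congr 1
      refine Finset.prod_congr rfl fun j hj => ?_
      rw [Finset.mem_Ico] at hj
      rw [jpConj_eq hm]
      intro i _
      constructor
      · intro hi
        by_contra hc
        have := hf (not_lt.1 hc)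
        omega
      · intro hi
        have := hf (Nat.lt_succ_iff.1 hi)
        omega
  rw [← key M le_rfl, hM, Finset.range_eq_Ico]

lemma mul_prod_Ico_telescope (u : ℕ → ℝ) {a b : ℕ} (hab : a ≤ b) :
    u b * ∏ j ∈ Ico a b, u j = u a * ∏ j ∈ Ico a b, u (j + 1) := by
  induction b, hab using Nat.le_induction with
  | base => simp
  | succ b hab ih =>
    rw [Finset.prod_Ico_succ_top hab, Finset.prod_Ico_succ_top hab]
    linear_combination u (b + 1) * ih

lemma jackFirstRow_pos {θ : ℝ} (hθ : 0 < θ) (N : ℕ) (f : ℕ → ℕ) :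
    0 < jackFirstRow θ (N + 1) f := by
  refine Finset.prod_pos fun j hj => ?_
  rw [Finset.mem_range] at hj
  rw [jpConj_succ hj, jackCellFactor]
  have h1 : (j : ℝ) + 1 ≤ f 0 := by exact_mod_cast hj
  have h2 : (0 : ℝ) ≤ f 0 - j - 1 := by linarith
  push_cast
  rw [add_sub_cancel_right]
  positivity

lemma jackHookProd_pos {θ : ℝ} (hθ : 0 < θ) (N : ℕ) {f : ℕ → ℕ} (hf : Antitone f) :
    0 < jackHookProd θ N f := by
  induction N generalizing f with
  | zero => simp [jackHookProd]
  | succ N ih =>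
    rw [jackHookProd_succ θ N hf]
    exact mul_pos (jackFirstRow_pos hθ N f) (ih fun i j h => hf (Nat.succ_le_succ h))

lemma jackFirstRow_mul_jackUpRate_zero {θ : ℝ} (hθ : 0 < θ) (N : ℕ) {f g : ℕ → ℕ}
    (hf : Antitone f) (hN : f (N + 1) = 0) (hg0 : g 0 = f 0 + 1)
    (hg : ∀ i, g (i + 1) = f (i + 1)) :
    jackFirstRow θ (N + 1) g * jackUpRate θ (N + 1) f 0 =
      jackFirstRow θ (N + 1) f * jackDownRate θ (N + 1) g 0 := by
  set r : ℝ := ((f 0 : ℕ) : ℝ) with hr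
  set u : ℕ → ℕ → ℝ := fun i j => r - j + θ * (i + 1) with hu
  set v : ℕ → ℕ → ℝ := fun i j => r + 1 - j + θ * i with hv
  have hle : ∀ i, (f i : ℝ) ≤ r := fun i => Nat.cast_le.2 (hf i.zero_le)
  have hupos : ∀ i k, 0 < u i (f k) := fun i k => by
    have := hle k
    have : 0 ≤ r - f k := by linarith
    simp only [hu]
    positivity
  have hvpos : ∀ i k, 0 < v i (f k) := fun i k => by
    have := hle k
    have : 0 < r + 1 - f k := by linarith
    simp only [hv]
    positivity
  have hRf : jackFirstRow θ (N + 1) f =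
      ∏ i ∈ range (N + 1), ∏ j ∈ Ico (f (i + 1)) (f i), u i (j + 1) * v i (j + 1) := by
    rw [jackFirstRow, prod_jpConj hf hN (fun j c => jackCellFactor θ (f 0) j c)]
    refine Finset.prod_congr rfl fun i _ => Finset.prod_congr rfl fun j _ => ?_
    simp only [jackCellFactor, hu, hv, ← hr]
    push_cast
    ring
  have hconj : ∀ j < f 0, jpConj (N + 1) g j = jpConj (N + 1) f j := by
    intro j hj
    rw [jpConj_succ hj, jpConj_succ (by omega)]
    simp only [hg]
  have hconj0 : jpConj (N + 1) g (f 0) = 1 := by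
    apply jpConj_eq (by omega)
    rintro (_ | i) _
    · simp [hg0]
    · have := hf (Nat.zero_le (i + 1))
      rw [hg]
      omega
  have hRg : jackFirstRow θ (N + 1) g =
      θ * ∏ i ∈ range (N + 1), ∏ j ∈ Ico (f (i + 1)) (f i), u i j * v i j := by
    rw [jackFirstRow, hg0, Finset.prod_range_succ, hconj0, mul_comm]
    congr 1
    · simp [jackCellFactor]
    · have h := prod_jpConj hf hN (fun j c => (r - j + θ * c) * (r + 1 - j + θ * (c - 1)))
      have h' : ∏ i ∈ range (N + 1), ∏ j ∈ Ico (f (i + 1)) (f i), u i j * v i j =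
          ∏ i ∈ range (N + 1), ∏ j ∈ Ico (f (i + 1)) (f i),
            (r - j + θ * (i + 1 : ℕ)) * (r + 1 - j + θ * ((i + 1 : ℕ) - 1)) := by
        simp [hu, hv]
      rw [h', ← h]
      refine Finset.prod_congr rfl fun j hj => ?_
      rw [hconj j (Finset.mem_range.1 hj), jackCellFactor]
      push_cast
      ring
  have htel : jackFirstRow θ (N + 1) g *
      ((∏ i ∈ range (N + 1), u i (f i)) * ∏ i ∈ range (N + 1), v i (f i)) =
      θ * jackFirstRow θ (N + 1) f *
      ((∏ i ∈ range (N + 1), u i (f (i + 1))) * ∏ i ∈ range (N + 1), v i (f (i + 1))) := by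
    rw [hRg, hRf, mul_assoc, mul_assoc, ← Finset.prod_mul_distrib, ← Finset.prod_mul_distrib,
      ← Finset.prod_mul_distrib, ← Finset.prod_mul_distrib]
    congr 1
    refine Finset.prod_congr rfl fun i _ => ?_
    have h1 := mul_prod_Ico_telescope (u i) (hf i.le_succ)
    have h2 := mul_prod_Ico_telescope (v i) (hf i.le_succ)
    rw [Finset.prod_mul_distrib, Finset.prod_mul_distrib]
    linear_combination (v i (f i) * ∏ j ∈ Ico (f (i + 1)) (f i), v i j) * h1 +
      (u i (f (i + 1)) * ∏ j ∈ Ico (f (i + 1)) (f i), u i (j + 1)) * h2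
  have hp : jackUpRate θ (N + 1) f 0 =
      (∏ i ∈ range (N + 1), u i (f i)) / ∏ i ∈ range (N + 1), u i (f (i + 1)) := by
    rw [jackUpRate, Finset.prod_range_succ' _ (N + 1)]
    simp only [if_true, mul_one, Nat.add_eq_zero_iff, one_ne_zero, and_false, if_false]
    congr 1 <;> refine Finset.prod_congr rfl fun i _ => ?_ <;>
      simp only [jackContent, hu, ← hr] <;> push_cast <;> ring
  have hq : jackDownRate θ (N + 1) g 0 =
      θ * (∏ i ∈ range (N + 1), v i (f (i + 1))) / ∏ i ∈ range (N + 1), v i (f i) := by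
    rw [jackDownRate, Finset.prod_range_succ' _ (N + 1),
      Finset.prod_range_succ' (fun i => if i = 0 then (1 : ℝ) else
        jackContent θ g 0 - jackContent θ g i) N,
      Finset.prod_range_succ' (fun i => v i (f i)) N]
    simp only [if_true, mul_one, Nat.add_eq_zero_iff, one_ne_zero, and_false, if_false]
    have hv0 : v 0 (f 0) = 1 := by simp [hv, hr]
    rw [hv0, mul_one, ← mul_neg, mul_comm]
    congr 1
    · congr 1
      · ring
      · refine Finset.prod_congr rfl fun i _ => ?_
        simp only [jackContent, hv, hg0, hg, hr]
        push_cast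
        ring
    · refine Finset.prod_congr rfl fun i _ => ?_
      simp only [jackContent, hv, hg0, hg, hr]
      push_cast
      ring
  have n1 : ∏ i ∈ range (N + 1), u i (f (i + 1)) ≠ 0 :=
    Finset.prod_ne_zero_iff.2 fun i _ => (hupos i (i + 1)).ne'
  have n2 : ∏ i ∈ range (N + 1), v i (f i) ≠ 0 :=
    Finset.prod_ne_zero_iff.2 fun i _ => (hvpos i i).ne'
  rw [hp, hq, mul_div_assoc', mul_div_assoc', div_eq_div_iff n1 n2]
  linear_combination htel

lemma jackUpRate_succ (θ : ℝ) (N : ℕ) (f : ℕ → ℕ) (k : ℕ) :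
    jackUpRate θ (N + 1) f (k + 1) = jackUpRate θ N (fun i => f (i + 1)) k *
      ((f 0 - f (k + 1) + θ * k) / (f 0 - f (k + 1) + θ * (k + 1))) := by
  rw [jackUpRate, jackUpRate, Finset.prod_range_succ', Finset.prod_range_succ' _ (N + 1),
    div_mul_div_comm, ← neg_div_neg_eq, ← mul_neg, ← mul_neg]
  congr 1
  · congr 1
    · refine Finset.prod_congr rfl fun i _ => ?_
      simp only [jackContent]
      push_cast
      ring
    · simp only [jackContent]
      push_cast
      ring
  · congr 1
    · refine Finset.prod_congr rfl fun i _ => ?_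
      simp only [jackContent, Nat.add_right_cancel_iff]
      push_cast
      split_ifs <;> ring
    · rw [if_neg (Nat.succ_ne_zero k).symm]
      simp only [jackContent]
      push_cast
      ring

lemma neg_mul_neg_div (a b c d : ℝ) : -(a * -b) / (c * -d) = -a / c * (b / d) := by
  rw [mul_neg, neg_neg, mul_neg, div_neg, div_mul_div_comm, neg_mul, neg_div]

lemma jackDownRate_succ (θ : ℝ) (N : ℕ) (f : ℕ → ℕ) (k : ℕ) :
    jackDownRate θ (N + 1) f (k + 1) = jackDownRate θ N (fun i => f (i + 1)) k *
      ((f 0 - f (k + 1) + θ * (k + 2)) / (f 0 - f (k + 1) + θ * (k + 1))) := by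
  rw [jackDownRate, jackDownRate, Finset.prod_range_succ' _ (N + 1),
    Finset.prod_range_succ' (fun i => if i = k + 1 then (1 : ℝ) else
      jackContent θ f (k + 1) - jackContent θ f i) N,
    ← neg_mul_neg_div]
  congr 1
  · congr 2
    · refine Finset.prod_congr rfl fun i _ => ?_
      simp only [jackContent]
      push_cast
      ring
    · simp only [jackContent]
      push_cast
      ring
  · congr 1
    · refine Finset.prod_congr rfl fun i _ => ?_
      simp only [jackContent, Nat.add_right_cancel_iff]
      push_cast
      split_ifs <;> ring
    · rw [if_neg (Nat.succ_ne_zero k).symm]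
      simp only [jackContent]
      push_cast
      ring

/-- Adding a cell in row `k + 1` changes the hook lengths of the first row in one column only. -/
lemma jackFirstRow_add_cell (θ : ℝ) {N k : ℕ} {f g : ℕ → ℕ} (hf : Antitone f) (hk : k < N)
    (hgk : g (k + 1) = f (k + 1) + 1) (hg : ∀ i ≠ k + 1, g i = f i) (hga : Antitone g) :
    jackFirstRow θ (N + 1) g * jackCellFactor θ (f 0) (f (k + 1)) (k + 1) =
      jackFirstRow θ (N + 1) f * jackCellFactor θ (f 0) (f (k + 1)) (k + 2) := by
  have hg0 : g 0 = f 0 := hg 0 (Nat.succ_ne_zero k).symm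
  have hlt : f (k + 1) < f 0 := by
    have := hga (Nat.zero_le (k + 1))
    omega
  have hcf : jpConj (N + 1) f (f (k + 1)) = k + 1 := by
    refine jpConj_eq (by omega) fun i _ => ⟨fun hi => ?_, fun hi => ?_⟩
    · by_contra hc
      have := hf (not_lt.1 hc)
      omega
    · have := hga (show i ≤ k + 1 by omega)
      rw [hg i (by omega)] at this
      omega
  have hcg : jpConj (N + 1) g (f (k + 1)) = k + 2 := by
    refine jpConj_eq (by omega) fun i _ => ⟨fun hi => ?_, fun hi => ?_⟩
    · by_contra hc
      have := hf (show k + 1 ≤ i by omega)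
      rw [hg i (by omega)] at hi
      omega
    · have := hga (show i ≤ k + 1 by omega)
      omega
  have hne : ∀ j ≠ f (k + 1), jpConj (N + 1) g j = jpConj (N + 1) f j := by
    intro j hj
    unfold jpConj
    congr 1
    refine Finset.filter_congr fun i _ => ?_
    obtain rfl | hi := eq_or_ne i (k + 1)
    · omega
    · rw [hg i hi]
  rw [jackFirstRow, jackFirstRow, hg0, ← Finset.mul_prod_erase _ _ (Finset.mem_range.2 hlt),
    ← Finset.mul_prod_erase (range (f 0)) (fun j => jackCellFactor θ (f 0) j (jpConj (N + 1) f j))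
      (Finset.mem_range.2 hlt), hcf, hcg,
    Finset.prod_congr rfl fun j hj => by rw [hne j (Finset.ne_of_mem_erase hj)]]
  push_cast
  ring

/-- Detailed balance between the growth process and its reversal. -/
lemma jackHookProd_mul_jackUpRate {θ : ℝ} (hθ : 0 < θ) {N k : ℕ} {f g : ℕ → ℕ} (hf : Antitone f)
    (hN : f N = 0) (hk : k < N) (hgk : g k = f k + 1) (hg : ∀ i ≠ k, g i = f i)
    (hga : Antitone g) :
    jackHookProd θ N g * jackUpRate θ N f k = jackHookProd θ N f * jackDownRate θ N g k := by
  induction N generalizing f g k with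
  | zero => omega
  | succ N ih =>
    rw [jackHookProd_succ θ N hf, jackHookProd_succ θ N hga]
    obtain _ | k := k
    · have htail : ∀ i, g (i + 1) = f (i + 1) := fun i => hg _ (Nat.succ_ne_zero i)
      have h := jackFirstRow_mul_jackUpRate_zero hθ N hf hN hgk htail
      simp only [htail]
      linear_combination jackHookProd θ N (fun i => f (i + 1)) * h
    · have h := jackFirstRow_add_cell θ hf (Nat.lt_of_succ_lt_succ hk) hgk hg hga
      have ih' := ih (f := fun i => f (i + 1)) (g := fun i => g (i + 1))
        (fun i j hij => hf (Nat.succ_le_succ hij)) hN (Nat.lt_of_succ_lt_succ hk) hgk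
        (fun i hi => hg _ (by omega)) (fun i j hij => hga (Nat.succ_le_succ hij))
      have hg0 : g 0 = f 0 := hg 0 (Nat.succ_ne_zero k).symm
      have hle : (f (k + 1) : ℝ) + 1 ≤ f 0 := by
        have := hga (Nat.zero_le (k + 1))
        rw [hgk, hg0] at this
        exact_mod_cast this
      rw [jackUpRate_succ, jackDownRate_succ, hgk, hg0]
      obtain ⟨a, ha⟩ : ∃ a : ℝ, a = f 0 - f (k + 1) - 1 := ⟨_, rfl⟩
      have ha0 : 0 ≤ a := by linarith
      have hf0 : (f 0 : ℝ) = a + f (k + 1) + 1 := by linarith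
      simp only [jackCellFactor, hf0] at h
      have hk0 : (0 : ℝ) ≤ k := k.cast_nonneg
      have e1 : a + f (k + 1) + 1 - f (k + 1) - 1 + θ * ((k : ℝ) + 1 - 1) + θ = a + θ * (k + 1) := by
        ring
      have e2 : a + f (k + 1) + 1 - f (k + 1) - 1 + θ * ((k : ℝ) + 1 - 1) + 1 = a + 1 + θ * k := by
        ring
      have e3 : a + f (k + 1) + 1 - f (k + 1) - 1 + θ * ((k : ℝ) + 2 - 1) + θ = a + θ * (k + 2) := by
        ring
      have e4 : a + f (k + 1) + 1 - f (k + 1) - 1 + θ * ((k : ℝ) + 2 - 1) + 1 =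
          a + 1 + θ * (k + 1) := by
        ring
      rw [e1, e2, e3, e4] at h
      have d1 : (f 0 : ℝ) - f (k + 1) + θ * k = a + 1 + θ * k := by rw [hf0]; ring
      have d2 : (f 0 : ℝ) - f (k + 1) + θ * (k + 1) = a + 1 + θ * (k + 1) := by rw [hf0]; ring
      have d3 : (f 0 : ℝ) - (f (k + 1) + 1 : ℕ) + θ * (k + 2) = a + θ * (k + 2) := by
        rw [hf0]; push_cast; ring
      have d4 : (f 0 : ℝ) - (f (k + 1) + 1 : ℕ) + θ * (k + 1) = a + θ * (k + 1) := by
        rw [hf0]; push_cast; ring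
      rw [d1, d2, d3, d4]
      have p1 : a + θ * (k + 1) ≠ 0 := by positivity
      have p2 : a + 1 + θ * (k + 1) ≠ 0 := by positivity
      rw [mul_div_assoc', mul_div_assoc', mul_div_assoc', mul_div_assoc', div_eq_div_iff p2 p1]
      linear_combination (jackFirstRow θ (N + 1) g * (a + 1 + θ * k) * (a + θ * (k + 1))) * ih' +
        (jackHookProd θ N (fun i => f (i + 1)) *
          jackDownRate θ N (fun i => g (i + 1)) k) * h

/-- Partitions of `n` with at most `N` parts. -/
noncomputable def jackPartitions (N n : ℕ) : Finset (ℕ → ℕ) :=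
  open Classical in (Finset.piAntidiag (range N) n).filter Antitone

lemma mem_jackPartitions {N n : ℕ} {f : ℕ → ℕ} :
    f ∈ jackPartitions N n ↔ Antitone f ∧ f N = 0 ∧ ∑ i ∈ range N, f i = n := by
  simp only [jackPartitions, Finset.mem_filter, Finset.mem_piAntidiag, Finset.mem_range]
  constructor
  · rintro ⟨⟨h1, h2⟩, h3⟩
    exact ⟨h3, by_contra fun h => lt_irrefl _ (h2 N h), h1⟩
  · rintro ⟨h1, h2, h3⟩
    refine ⟨⟨h3, fun i hi => ?_⟩, h1⟩
    by_contra hc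
    have := h1 (not_lt.1 hc)
    omega

lemma sum_jackUpRate_eq_sum_jackDownRate {θ : ℝ} (hθ : 0 < θ) (N n : ℕ) :
    ∑ f ∈ jackPartitions N n, ∑ k ∈ range N, jackUpRate θ N f k / jackHookProd θ N f =
      ∑ g ∈ jackPartitions N (n + 1), ∑ k ∈ range N,
        jackDownRate θ N g k / jackHookProd θ N g := by
  rw [← Finset.sum_product', ← Finset.sum_product']
  have up_anti : ∀ f ∈ jackPartitions N n, ∀ k < N, jackUpRate θ N f k ≠ 0 →
      Antitone (Function.update f k (f k + 1)) := by
    intro f hf k hk h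
    obtain ⟨hf, -, -⟩ := mem_jackPartitions.1 hf
    refine antitone_nat_of_succ_le fun i => ?_
    have hi : f (i + 1) ≤ f i := hf i.le_succ
    simp only [Function.update_apply]
    split_ifs with h1 h2 h2
    · omega
    · obtain rfl := h1
      have : f i ≠ f (i + 1) := fun hc => h (jackUpRate_eq_zero hk.le hc)
      omega
    · subst h2; omega
    · exact hi
  have down_pos : ∀ g ∈ jackPartitions N (n + 1), ∀ k < N, jackDownRate θ N g k ≠ 0 →
      g (k + 1) < g k := by
    intro g hg k hk h
    exact ((mem_jackPartitions.1 hg).1 k.le_succ).lt_of_ne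
      fun hc => h (jackDownRate_eq_zero hk hc.symm)
  have sum_upd : ∀ (f : ℕ → ℕ) (k : ℕ), k < N →
      ∑ i ∈ range N, Function.update f k (f k + 1) i = ∑ i ∈ range N, f i + 1 := by
    intro f k hk
    have hk' := Finset.mem_range.2 hk
    rw [← Finset.add_sum_erase _ _ hk', ← Finset.add_sum_erase _ f hk', Function.update_self,
      Finset.sum_congr rfl fun i hi => Function.update_of_ne (Finset.ne_of_mem_erase hi) _ f]
    ring
  refine Finset.sum_bij_ne_zero (fun p _ _ => (Function.update p.1 p.2 (p.1 p.2 + 1), p.2))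
    ?_ ?_ ?_ ?_
  · rintro ⟨f, k⟩ h hne
    simp only [Finset.mem_product, Finset.mem_range] at h ⊢
    obtain ⟨hf, hk⟩ := h
    have hne' : jackUpRate θ N f k ≠ 0 := fun hc => hne (by simp [hc])
    refine ⟨mem_jackPartitions.2 ⟨up_anti f hf k hk hne', ?_, ?_⟩, hk⟩
    · rw [Function.update_of_ne hk.ne']
      exact (mem_jackPartitions.1 hf).2.1
    · rw [sum_upd f k hk, (mem_jackPartitions.1 hf).2.2]
  · rintro ⟨f, k⟩ _ _ ⟨g, l⟩ _ _ h
    simp only [Prod.mk.injEq] at h ⊢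
    obtain ⟨h, rfl⟩ := h
    refine ⟨funext fun i => ?_, rfl⟩
    have := congrFun h i
    simp only [Function.update_apply] at this
    split_ifs at this with hi
    · subst hi; omega
    · exact this
  · rintro ⟨g, k⟩ h hne
    simp only [Finset.mem_product, Finset.mem_range] at h
    obtain ⟨hg, hk⟩ := h
    have hne' : jackDownRate θ N g k ≠ 0 := fun hc => hne (by simp [hc])
    have hlt := down_pos g hg k hk hne'
    obtain ⟨hga, hgN, hgs⟩ := mem_jackPartitions.1 hg
    set f := Function.update g k (g k - 1) with hf
    have hupd : Function.update f k (f k + 1) = g := by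
      rw [hf, Function.update_self, Function.update_idem, Nat.sub_add_cancel (by omega),
        Function.update_eq_self]
    have hfa : Antitone f := by
      refine antitone_nat_of_succ_le fun i => ?_
      have hi : g (i + 1) ≤ g i := hga i.le_succ
      simp only [hf, Function.update_apply]
      split_ifs with h1 h2 h2
      · omega
      · subst h1; omega
      · subst h2; omega
      · exact hi
    have hfm : f ∈ jackPartitions N n := by
      refine mem_jackPartitions.2 ⟨hfa, ?_, ?_⟩
      · rw [hf, Function.update_of_ne hk.ne', hgN]
      · have := sum_upd f k hk
        rw [hupd] at this
        omega
    refine ⟨(f, k), by simp [hfm, hk], ?_, by simp only [hupd]⟩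
    have hbal := jackHookProd_mul_jackUpRate hθ hfa (mem_jackPartitions.1 hfm).2.1 hk
      (g := g) (by rw [hf, Function.update_self]; omega)
      (fun i hi => by rw [hf, Function.update_of_ne hi]) hga
    have hne1 := (jackHookProd_pos hθ N hfa).ne'
    refine div_ne_zero (fun hc => ?_) hne1
    rw [hc, mul_zero] at hbal
    exact mul_ne_zero hne1 hne' hbal.symm
  · rintro ⟨f, k⟩ h hne
    simp only [Finset.mem_product, Finset.mem_range] at h ⊢
    obtain ⟨hf, hk⟩ := h
    have hga := up_anti f hf k hk fun hc => hne (by simp [hc])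
    obtain ⟨hfa, hfN, -⟩ := mem_jackPartitions.1 hf
    rw [div_eq_div_iff (jackHookProd_pos hθ N hfa).ne' (jackHookProd_pos hθ N hga).ne']
    have hbal := jackHookProd_mul_jackUpRate hθ hfa hfN hk (Function.update_self k (f k + 1) f)
      (fun i hi => Function.update_of_ne hi _ _) hga
    linear_combination hbal

/-- The Jack–Plancherel measure has total mass one. -/
lemma sum_inv_jackHookProd {θ : ℝ} (hθ : 0 < θ) {N n : ℕ} (hn : n ≤ N) :
    ∑ f ∈ jackPartitions N n, (jackHookProd θ N f)⁻¹ = ((n.factorial : ℝ) * θ ^ n)⁻¹ := by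
  induction n with
  | zero =>
    have h0 : jackPartitions N 0 = {0} := by
      ext f
      rw [mem_jackPartitions, Finset.mem_singleton]
      constructor
      · rintro ⟨hf, hfN, hs⟩
        funext i
        rw [Finset.sum_eq_zero_iff] at hs
        obtain hi | hi := lt_or_ge i N
        · exact hs i (Finset.mem_range.2 hi)
        · have := hf hi
          simp only [Pi.zero_apply]
          omega
      · rintro rfl
        exact ⟨antitone_const, rfl, by simp⟩
    simp [h0, jackHookProd]
  | succ n ih =>
    have h := sum_jackUpRate_eq_sum_jackDownRate hθ N n
    have hup : ∀ f ∈ jackPartitions N n,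
        ∑ k ∈ range N, jackUpRate θ N f k / jackHookProd θ N f = (jackHookProd θ N f)⁻¹ := by
      intro f hf
      obtain ⟨hfa, hfN, hfs⟩ := mem_jackPartitions.1 hf
      rw [← Finset.sum_div]
      have h1 := sum_jackUpRate hθ N hfa
      obtain ⟨M, rfl⟩ : ∃ M, N = M + 1 := ⟨N - 1, by omega⟩
      have hM : f M = 0 := by
        by_contra hc
        have : ∑ i ∈ range (M + 1), 1 ≤ ∑ i ∈ range (M + 1), f i :=
          Finset.sum_le_sum fun i hi => by
            have := hfa (Nat.lt_succ_iff.1 (Finset.mem_range.1 hi))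
            omega
        simp only [Finset.sum_const, card_range, smul_eq_mul, mul_one] at this
        omega
      rw [Finset.sum_range_succ, jackUpRate_eq_zero le_rfl (hM.trans hfN.symm), add_zero] at h1
      rw [h1, one_div]
    have hdown : ∀ g ∈ jackPartitions N (n + 1),
        ∑ k ∈ range N, jackDownRate θ N g k / jackHookProd θ N g =
          θ * (n + 1) * (jackHookProd θ N g)⁻¹ := by
      intro g hg
      obtain ⟨hga, hgN, hgs⟩ := mem_jackPartitions.1 hg
      rw [← Finset.sum_div, sum_jackDownRate hθ N hga hgN, ← Nat.cast_sum, hgs, div_eq_mul_inv]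
      push_cast
      ring
    rw [Finset.sum_congr rfl hup, Finset.sum_congr rfl hdown, ← Finset.mul_sum,
      ih (by omega)] at h
    have hn0 : (0 : ℝ) < θ * (n + 1) := by positivity
    rw [← mul_right_inj' hn0.ne', ← h, Nat.factorial_succ]
    push_cast
    field_simp
    ring

lemma le_jackFirstRow {θ : ℝ} (hθ : 0 < θ) {N l : ℕ} {f : ℕ → ℕ} (hf : f 0 = l + 1) :
    θ * l.factorial * (l + 1).factorial ≤ jackFirstRow θ (N + 1) f := by
  have h1 : ∏ j ∈ range (l + 1), ((j : ℝ) + θ) * (j + 1) ≤ jackFirstRow θ (N + 1) f := by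
    rw [← Finset.prod_range_reflect, jackFirstRow, hf]
    refine Finset.prod_le_prod (fun j _ => by positivity) fun j hj => ?_
    have hj' := Finset.mem_range.1 hj
    have hcast : ((l + 1 - 1 - j : ℕ) : ℝ) = (l + 1 : ℕ) - j - 1 := by
      rw [Nat.add_sub_cancel, Nat.cast_sub (Nat.lt_succ_iff.1 hj')]
      push_cast
      ring
    rw [jpConj_succ (hf ▸ hj'), jackCellFactor, ← hcast]
    push_cast
    rw [add_sub_cancel_right]
    have h0 : 0 ≤ θ * (jpConj N (fun i => f (i + 1)) j : ℝ) := by positivity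
    gcongr <;> linarith
  refine le_trans ?_ h1
  rw [Finset.prod_mul_distrib, Finset.prod_range_succ', ← Finset.prod_range_add_one_eq_factorial,
    ← Finset.prod_range_add_one_eq_factorial]
  push_cast
  rw [zero_add, mul_comm θ]
  have hp : ∏ j ∈ range l, ((j : ℝ) + 1) ≤ ∏ j ∈ range l, ((j : ℝ) + 1 + θ) :=
    Finset.prod_le_prod (fun j _ => by positivity) fun j _ => by linarith
  exact mul_le_mul_of_nonneg_right (mul_le_mul_of_nonneg_right hp hθ.le) (by positivity)

lemma div_exp_one_pow_le_factorial_mul (l : ℕ) :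
    (((l + 1 : ℕ) : ℝ) / Real.exp 1) ^ (2 * (l + 1)) ≤ (l.factorial : ℝ) * (l + 1).factorial := by
  have h := Stirling.le_factorial_stirling (l + 1)
  have hm : (0 : ℝ) < ((l + 1 : ℕ) : ℝ) := by positivity
  set q : ℝ := ((l + 1 : ℕ) : ℝ) / Real.exp 1 with hq
  have hq0 : 0 ≤ q := by positivity
  have h2 := mul_self_le_mul_self (by positivity) h
  have h3 : √(2 * Real.pi * (l + 1 : ℕ)) * q ^ (l + 1) * (√(2 * Real.pi * (l + 1 : ℕ)) * q ^ (l + 1))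
      = 2 * Real.pi * ((l + 1 : ℕ) * q ^ (2 * (l + 1))) := by
    rw [mul_mul_mul_comm, Real.mul_self_sqrt (by positivity)]
    ring
  rw [h3] at h2
  have h4 : ((l + 1 : ℕ) : ℝ) * q ^ (2 * (l + 1)) ≤
      2 * Real.pi * ((l + 1 : ℕ) * q ^ (2 * (l + 1))) :=
    le_mul_of_one_le_left (by positivity) (by linarith [Real.pi_gt_three])
  refine le_of_mul_le_mul_left (h4.trans (h2.trans_eq ?_)) hm
  rw [Nat.factorial_succ]
  push_cast
  ring

lemma factorial_div_le_exp_bound {θ : ℝ} (hθ : 0 < θ) {n l : ℕ} (hl : l + 1 ≤ n) :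
    (n.factorial : ℝ) * θ ^ n / (θ * l.factorial * (l + 1).factorial) *
        (((n - (l + 1)).factorial : ℝ) * θ ^ (n - (l + 1)))⁻¹ ≤
      θ⁻¹ * (Real.exp 1 ^ 2 * n * θ / ((l + 1 : ℕ) : ℝ) ^ 2) ^ (l + 1) := by
  have hd : (n.factorial : ℝ) ≤ (n - (l + 1)).factorial * (n : ℝ) ^ (l + 1) := by
    rw [← Nat.factorial_mul_descFactorial hl]
    exact_mod_cast Nat.mul_le_mul_left _ (Nat.descFactorial_le_pow n (l + 1))
  have hs := div_exp_one_pow_le_factorial_mul l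
  have hθn : θ ^ n = θ ^ (n - (l + 1)) * θ ^ (l + 1) := by rw [← pow_add, Nat.sub_add_cancel hl]
  have hq : 0 < (((l + 1 : ℕ) : ℝ) / Real.exp 1) ^ (2 * (l + 1)) := by positivity
  calc _ ≤ ((n - (l + 1)).factorial * (n : ℝ) ^ (l + 1)) * θ ^ n /
        (θ * (((l + 1 : ℕ) : ℝ) / Real.exp 1) ^ (2 * (l + 1))) *
        (((n - (l + 1)).factorial : ℝ) * θ ^ (n - (l + 1)))⁻¹ := by
        rw [mul_assoc θ]
        gcongr
    _ = _ := by
        have hne : ((n - (l + 1)).factorial : ℝ) ≠ 0 := by positivity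
        rw [hθn]
        simp only [div_pow, mul_pow, ← pow_mul]
        field_simp

lemma sum_jackPlancherelWeight_first_row_le {θ : ℝ} (hθ : 0 < θ) {N l : ℕ} (hl : l ≤ N) :
    ∑ f ∈ jackPartitions (N + 1) (N + 1) with f 0 = l + 1, jackPlancherelWeight θ (N + 1) f ≤
      ((N + 1).factorial : ℝ) * θ ^ (N + 1) / (θ * l.factorial * (l + 1).factorial) *
        (((N + 1 - (l + 1)).factorial : ℝ) * θ ^ (N + 1 - (l + 1)))⁻¹ := by
  classical
  set S := (jackPartitions (N + 1) (N + 1)).filter (fun f => f 0 = l + 1) with hS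
  set tail : (ℕ → ℕ) → ℕ → ℕ := fun f i => f (i + 1) with htail
  have hmem : ∀ f ∈ S, Antitone f ∧ f (N + 1) = 0 ∧ ∑ i ∈ range (N + 1), f i = N + 1 ∧
      f 0 = l + 1 := by
    intro f hf
    obtain ⟨hf, hf0⟩ := Finset.mem_filter.1 hf
    obtain ⟨h1, h2, h3⟩ := mem_jackPartitions.1 hf
    exact ⟨h1, h2, h3, hf0⟩
  have htail_anti : ∀ f ∈ S, Antitone (tail f) := fun f hf i j hij =>
    (hmem f hf).1 (Nat.succ_le_succ hij)
  have hinj : Set.InjOn tail S := by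
    intro f hf g hg h
    funext i
    obtain _ | i := i
    · rw [(hmem f hf).2.2.2, (hmem g hg).2.2.2]
    · exact congrFun h i
  have hsub : S.image tail ⊆ jackPartitions N (N + 1 - (l + 1)) := by
    intro g hg
    obtain ⟨f, hf, rfl⟩ := Finset.mem_image.1 hg
    obtain ⟨_, h2, h3, h4⟩ := hmem f hf
    refine mem_jackPartitions.2 ⟨htail_anti f hf, h2, ?_⟩
    rw [Finset.sum_range_succ'] at h3
    simp only [htail]
    omega
  have hpos : ∀ g ∈ jackPartitions N (N + 1 - (l + 1)), 0 ≤ (jackHookProd θ N g)⁻¹ := fun g hg =>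
    (inv_pos.2 (jackHookProd_pos hθ N (mem_jackPartitions.1 hg).1)).le
  have hterm : ∀ f ∈ S, jackPlancherelWeight θ (N + 1) f ≤
      ((N + 1).factorial : ℝ) * θ ^ (N + 1) / (θ * l.factorial * (l + 1).factorial) *
        (jackHookProd θ N (tail f))⁻¹ := by
    intro f hf
    obtain ⟨h1, -, -, h4⟩ := hmem f hf
    have hw : jackPlancherelWeight θ (N + 1) f =
        ((N + 1).factorial : ℝ) * θ ^ (N + 1) / jackHookProd θ (N + 1) f := rfl
    have hH := jackHookProd_pos hθ N (htail_anti f hf)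
    rw [hw, jackHookProd_succ θ N h1, ← div_div, div_eq_mul_inv _ (jackHookProd θ N _)]
    gcongr
    exact le_jackFirstRow hθ h4
  refine (Finset.sum_le_sum hterm).trans ?_
  rw [← Finset.mul_sum, ← sum_inv_jackHookProd hθ (N := N) (by omega),
    ← Finset.sum_image (f := fun g => (jackHookProd θ N g)⁻¹) hinj]
  exact mul_le_mul_of_nonneg_left
    (Finset.sum_le_sum_of_subset_of_nonneg hsub fun g hg _ => hpos g hg) (by positivity)

/-- Fix `θ > 0`.  For the Jack–Plancherel measure `M^{(n)}_θ` on partitions of `n`, for every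
`n ≥ 1` and every `m ∈ {1,…,n}`, the probability that `λ₁ = m` is at most
`θ⁻¹·(e²nθ/m²)^m`.  (A partition of `n` is encoded as an antitone `f : ℕ → ℕ` with
`∑_{i<n} f i = n` and `f n = 0`; its largest part is `f 0`.) -/
theorem jackPlancherel_first_row_eq_bound (θ : ℝ) (hθ : 0 < θ) (n m : ℕ) (hn : 1 ≤ n)
    (hm : 1 ≤ m) (hmn : m ≤ n) :
    (∑' f : {f : ℕ → ℕ // Antitone f},
        if (∑ i ∈ Finset.range n, f.1 i) = n ∧ f.1 n = 0 ∧ f.1 0 = m then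
          jackPlancherelWeight θ n f.1 else 0)
      ≤ θ⁻¹ * (Real.exp 1 ^ 2 * n * θ / (m : ℝ) ^ 2) ^ m := by
  obtain ⟨N, rfl⟩ : ∃ N, n = N + 1 := ⟨n - 1, by omega⟩
  obtain ⟨l, rfl⟩ : ∃ l, m = l + 1 := ⟨m - 1, by omega⟩
  refine le_trans (le_of_eq ?_) ((sum_jackPlancherelWeight_first_row_le hθ
    (Nat.le_of_succ_le_succ hmn)).trans (factorial_div_le_exp_bound hθ hmn))
  refine (tsum_subtype {f : ℕ → ℕ | Antitone f} fun f =>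
      if (∑ i ∈ Finset.range (N + 1), f i) = N + 1 ∧ f (N + 1) = 0 ∧ f 0 = l + 1 then
        jackPlancherelWeight θ (N + 1) f else 0).trans ?_
  rw [tsum_eq_sum (s := jackPartitions (N + 1) (N + 1)), Finset.sum_filter]
  · refine Finset.sum_congr rfl fun f hf => ?_
    obtain ⟨h1, h2, h3⟩ := mem_jackPartitions.1 hf
    rw [Set.indicator_of_mem (Set.mem_ofPred.2 h1)]
    simp only [h2, h3, true_and]
  · intro f hf
    rw [Set.indicator_apply_eq_zero]
    exact fun h1 => if_neg fun h => hf (mem_jackPartitions.2 ⟨h1, h.2.1, h.1⟩)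
end

section
/- Fix θ > 0 and A₁ > 0. There exist constants b₁, B₁ > 0 depending only on θ and A₁ such that for all n ≥ 1 and all u ≥ b₁, the Jack–Plancherel measure satisfies M^{(n)}_θ(λ₁ ≥ u√n) ≤ B₁·e^{−A₁·u√n}. -/
open Finset

theorem prod_one_sub_div_eq_one_sub_sum {ι : Type*} [DecidableEq ι] (θ : ℝ) (x : ι → ℝ)
    (hx : Function.Injective x) (s : Finset ι) (z : ℝ) (hz : ∀ i ∈ s, z ≠ x i) :
    ∏ k ∈ s, (1 - θ / (z - x k)) =
      1 - θ * ∑ i ∈ s, (∏ k ∈ s.erase i, (1 - θ / (x i - x k))) / (z - x i) := by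
  induction s using Finset.induction_on generalizing z with
  | empty => simp
  | insert a s ha ih =>
    have hne : ∀ i ∈ s, x i ≠ x a := fun i hi h => ha (hx h ▸ hi)
    have hza : z - x a ≠ 0 := sub_ne_zero.2 (hz a (mem_insert_self _ _))
    have h1 := ih z fun i hi => hz i (mem_insert_of_mem hi)
    have h2 := ih (x a) fun i hi => (hne i hi).symm
    rw [prod_insert ha, sum_insert ha, erase_insert ha, h1, h2]
    have h3 : ∑ i ∈ s, (∏ k ∈ (insert a s).erase i, (1 - θ / (x i - x k))) / (z - x i) =
        ∑ i ∈ s, (∏ k ∈ s.erase i, (1 - θ / (x i - x k))) / (z - x i) * (1 - θ / (z - x a)) +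
        ∑ i ∈ s, (∏ k ∈ s.erase i, (1 - θ / (x i - x k))) / (x a - x i) * (θ / (z - x a)) := by
      rw [← sum_add_distrib]
      refine sum_congr rfl fun i hi => ?_
      have hia : a ≠ i := fun h => ha (h ▸ hi)
      rw [erase_insert_of_ne hia, prod_insert (by simp [ha])]
      have e1 : x i - x a ≠ 0 := sub_ne_zero.2 (hne i hi)
      have e2 : x a - x i ≠ 0 := sub_ne_zero.2 (hne i hi).symm
      have e3 : z - x i ≠ 0 := sub_ne_zero.2 (hz i (mem_insert_of_mem hi))
      have e4 : x a - x i = -(x i - x a) := by ring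
      rw [e4]
      field_simp
      ring
    rw [h3, ← sum_mul, ← sum_mul]
    field_simp
    ring

theorem sum_prod_one_sub_div {ι : Type*} [DecidableEq ι] (θ : ℝ) (x : ι → ℝ)
    (hx : Function.Injective x) (s : Finset ι) :
    ∑ i ∈ s, ∏ k ∈ s.erase i, (1 - θ / (x i - x k)) = s.card ∧
    ∑ i ∈ s, x i * ∏ k ∈ s.erase i, (1 - θ / (x i - x k)) =
      ∑ i ∈ s, x i - θ * (s.card * (s.card - 1) / 2) := by
  induction s using Finset.induction_on with
  | empty => simp
  | insert a s ha ih =>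
    obtain ⟨ih1, ih2⟩ := ih
    have hne : ∀ i ∈ s, x i ≠ x a := fun i hi h => ha (hx h ▸ hi)
    have h2 := prod_one_sub_div_eq_one_sub_sum θ x hx s (x a) fun i hi => (hne i hi).symm
    have key : ∀ i ∈ s, ∏ k ∈ (insert a s).erase i, (1 - θ / (x i - x k)) =
        ∏ k ∈ s.erase i, (1 - θ / (x i - x k)) +
          θ * ((∏ k ∈ s.erase i, (1 - θ / (x i - x k))) / (x a - x i)) := by
      intro i hi
      have hia : a ≠ i := fun h => ha (h ▸ hi)
      rw [erase_insert_of_ne hia, prod_insert (by simp [ha])]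
      have e1 : x i - x a ≠ 0 := sub_ne_zero.2 (hne i hi)
      have e4 : x a - x i = -(x i - x a) := by ring
      rw [e4]
      field_simp
      ring
    have key2 : ∀ i ∈ s, x i * ∏ k ∈ (insert a s).erase i, (1 - θ / (x i - x k)) =
        x i * ∏ k ∈ s.erase i, (1 - θ / (x i - x k)) -
          θ * ∏ k ∈ s.erase i, (1 - θ / (x i - x k)) +
          θ * x a * ((∏ k ∈ s.erase i, (1 - θ / (x i - x k))) / (x a - x i)) := by
      intro i hi
      have e1 : x a - x i ≠ 0 := sub_ne_zero.2 (hne i hi).symm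
      rw [key i hi]
      field_simp
      ring
    rw [sum_insert ha, sum_insert ha, sum_insert ha, erase_insert ha, h2, card_insert_of_notMem ha]
    rw [sum_congr rfl key, sum_congr rfl key2]
    simp only [sum_add_distrib, sum_sub_distrib, ← mul_sum, ih1, ih2]
    push_cast
    constructor <;> ring

/-- The factor of the hook product contributed by row `i` and additive parameter `t`. -/
noncomputable def hookRow (θ t : ℝ) (N : ℕ) (f : ℕ → ℕ) (i : ℕ) : ℝ :=
  ∏ j ∈ range (f i), (((f i : ℝ) - j - 1) + θ * ((jpConj N f j : ℝ) - i - 1) + t)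

/-- The full two-parameter hook product over the first `N` rows. -/
noncomputable def hookProd (θ : ℝ) (N : ℕ) (f : ℕ → ℕ) : ℝ :=
  ∏ i ∈ range N, hookRow θ θ N f i * hookRow θ 1 N f i

theorem jackPlancherelWeight_eq (θ : ℝ) (n : ℕ) (f : ℕ → ℕ) :
    jackPlancherelWeight θ n f = (n.factorial : ℝ) * θ ^ n / hookProd θ n f := by
  simp only [jackPlancherelWeight, hookProd, hookRow, prod_mul_distrib]

theorem jpConj_succ_s10 (N : ℕ) (f : ℕ → ℕ) (j : ℕ) :
    jpConj (N + 1) f j = jpConj N f j + if j < f N then 1 else 0 := by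
  unfold jpConj
  rw [range_add_one, filter_insert]
  split_ifs <;> simp

theorem le_jpConj {N : ℕ} {f : ℕ → ℕ} (hf : Antitone f) {i j : ℕ} (hi : i < N) (hj : j < f i) :
    i + 1 ≤ jpConj N f j := by
  unfold jpConj
  rw [← card_range (i + 1)]
  refine card_le_card fun k hk => ?_
  have hk' : k ≤ i := by simpa [Nat.lt_succ_iff] using hk
  exact mem_filter.2 ⟨mem_range.2 (by omega), hj.trans_le (hf hk')⟩

theorem jpConj_eq_s10 {N : ℕ} {f : ℕ → ℕ} {m j : ℕ} (hm : m ≤ N) (h1 : ∀ i < m, j < f i)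
    (h2 : ∀ i, m ≤ i → f i ≤ j) : jpConj N f j = m := by
  unfold jpConj
  rw [← card_range m]
  congr 1
  ext k
  simp only [mem_filter, mem_range]
  constructor
  · rintro ⟨_, h⟩
    by_contra h'
    exact absurd (h2 k (by omega)) (by omega)
  · exact fun h => ⟨by omega, h1 k h⟩

theorem jpConj_eq_self {N : ℕ} {f : ℕ → ℕ} (hf : Antitone f) {j : ℕ} (hj : j < f N) :
    jpConj N f j = N := by
  unfold jpConj
  rw [filter_true_of_mem, card_range]
  exact fun k hk => hj.trans_le (hf (mem_range.1 hk).le)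

theorem jpConj_update {N : ℕ} {f : ℕ → ℕ} {m : ℕ} (hm : m < N) (j : ℕ) :
    jpConj N (Function.update f m (f m + 1)) j = jpConj N f j + if j = f m then 1 else 0 := by
  induction N with
  | zero => omega
  | succ N ih =>
    rw [jpConj_succ_s10, jpConj_succ_s10]
    rcases Nat.lt_succ_iff_lt_or_eq.1 hm with h | rfl
    · rw [ih h, Function.update_of_ne (by omega)]
      ring
    · have : jpConj m (Function.update f m (f m + 1)) j = jpConj m f j := by
        unfold jpConj
        congr 1
        refine filter_congr fun k hk => ?_
        rw [Function.update_of_ne (mem_range.1 hk).ne]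
      rw [this, Function.update_self]
      split_ifs <;> omega

theorem hookRow_pos {θ t : ℝ} (hθ : 0 < θ) (ht : 0 < t) {N : ℕ} {f : ℕ → ℕ} (hf : Antitone f)
    {i : ℕ} (hi : i < N) : 0 < hookRow θ t N f i := by
  refine prod_pos fun j hj => ?_
  have hj' := mem_range.1 hj
  have h1 : ((i + 1 : ℕ) : ℝ) ≤ jpConj N f j := by exact_mod_cast le_jpConj hf hi hj'
  have h2 : ((j + 1 : ℕ) : ℝ) ≤ f i := by exact_mod_cast hj'
  push_cast at h1 h2
  have h3 : 0 ≤ θ * ((jpConj N f j : ℝ) - i - 1) := mul_nonneg hθ.le (by linarith)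
  linarith

theorem hookProd_pos {θ : ℝ} (hθ : 0 < θ) {N : ℕ} {f : ℕ → ℕ} (hf : Antitone f) :
    0 < hookProd θ N f :=
  prod_pos fun _ hi => mul_pos (hookRow_pos hθ hθ hf (mem_range.1 hi))
    (hookRow_pos hθ one_pos hf (mem_range.1 hi))

theorem hookProd_of_le (θ : ℝ) {f : ℕ → ℕ} (hf : Antitone f) {m N : ℕ} (hm : f m = 0)
    (h : m ≤ N) : hookProd θ N f = hookProd θ m f := by
  induction N, h using Nat.le_induction with
  | base => rfl
  | succ N hN ih =>
    have h0 : f N = 0 := Nat.le_zero.1 (hm ▸ hf hN)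
    have hc : ∀ j, jpConj (N + 1) f j = jpConj N f j := fun j => by simp [jpConj_succ_s10, h0]
    rw [← ih]
    simp only [hookProd, hookRow, hc]
    rw [prod_range_succ]
    simp [h0]

theorem prod_range_sub_mul_Gamma (F s : ℝ) (K : ℕ) (hs : 0 < s) (hK : (K : ℝ) ≤ F) :
    (∏ j ∈ range K, (F - j - 1 + s)) * Real.Gamma (F - K + s) = Real.Gamma (F + s) := by
  induction K with
  | zero => simp
  | succ K ih =>
    push_cast at hK ⊢
    rw [← ih (by linarith), prod_range_succ]
    have h : F - K + s = (F - K - 1 + s) + 1 := by ring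
    rw [h, Real.Gamma_add_one (by linarith), show F - (K + 1) + s = F - K - 1 + s by ring]
    ring

theorem hookRow_succ_mul_Gamma {θ t : ℝ} (hθ : 0 < θ) (ht : 0 < t) {f : ℕ → ℕ} (hf : Antitone f)
    {i N : ℕ} (hi : i < N) :
    hookRow θ t (N + 1) f i * Real.Gamma (f i - f N + θ * (N - i) + t) *
      Real.Gamma (f i + (θ * (N - i - 1) + t)) =
    hookRow θ t N f i * Real.Gamma (f i + (θ * (N - i) + t)) *
      Real.Gamma (f i - f N + θ * (N - i - 1) + t) := by
  have hle : f N ≤ f i := hf hi.le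
  have hle' : (f N : ℝ) ≤ f i := by exact_mod_cast hle
  have hi' : ((i : ℝ) + 1) ≤ N := by exact_mod_cast hi
  have p1 : 0 < θ * ((N : ℝ) - i) + t := by
    have := mul_nonneg hθ.le (show (0 : ℝ) ≤ N - i by linarith); linarith
  have p2 : 0 < θ * ((N : ℝ) - i - 1) + t := by
    have := mul_nonneg hθ.le (show (0 : ℝ) ≤ N - i - 1 by linarith); linarith
  rw [← prod_range_sub_mul_Gamma (f i) _ (f N) p1 hle',
    ← prod_range_sub_mul_Gamma (f i) _ (f N) p2 hle']
  unfold hookRow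
  rw [← prod_range_mul_prod_Ico _ hle,
    ← prod_range_mul_prod_Ico (fun j => (((f i : ℝ) - j - 1) +
      θ * ((jpConj N f j : ℝ) - i - 1) + t)) hle]
  have e1 : ∏ j ∈ range (f N), (((f i : ℝ) - j - 1) + θ * ((jpConj (N + 1) f j : ℝ) - i - 1) + t)
      = ∏ j ∈ range (f N), ((f i : ℝ) - j - 1 + (θ * (N - i) + t)) := by
    refine prod_congr rfl fun j hj => ?_
    have hj' := mem_range.1 hj
    rw [jpConj_succ_s10, jpConj_eq_self hf hj', if_pos hj']
    push_cast
    ring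
  have e2 : ∏ j ∈ range (f N), (((f i : ℝ) - j - 1) + θ * ((jpConj N f j : ℝ) - i - 1) + t)
      = ∏ j ∈ range (f N), ((f i : ℝ) - j - 1 + (θ * (N - i - 1) + t)) := by
    refine prod_congr rfl fun j hj => ?_
    rw [jpConj_eq_self hf (mem_range.1 hj)]
    ring
  have e3 : ∏ j ∈ Ico (f N) (f i),
        (((f i : ℝ) - j - 1) + θ * ((jpConj (N + 1) f j : ℝ) - i - 1) + t)
      = ∏ j ∈ Ico (f N) (f i),
        (((f i : ℝ) - j - 1) + θ * ((jpConj N f j : ℝ) - i - 1) + t) := by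
    refine prod_congr rfl fun j hj => ?_
    rw [jpConj_succ_s10, if_neg (by have := (mem_Ico.1 hj).1; omega), add_zero]
  rw [e1, e2, e3]
  simp only [add_assoc]
  ring

theorem hookRow_update_self {θ t : ℝ} (hθ : 0 < θ) (ht : 0 < t) {f : ℕ → ℕ} (hf : Antitone f)
    {m N : ℕ} (hm : m < N) (hf' : Antitone (Function.update f m (f m + 1))) :
    hookRow θ t N (Function.update f m (f m + 1)) m =
      hookRow θ t N f m * ((f m + (θ * (N - m - 1) + t)) *
        ∏ k ∈ Ico (m + 1) N, ((f m - f k + θ * (k - m - 1) + t) / (f m - f k + θ * (k - m) + t))) := by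
  induction N, hm using Nat.le_induction with
  | base =>
    have hc : ∀ g : ℕ → ℕ, Antitone g → ∀ j ∈ range (g m), jpConj (m + 1) g j = m + 1 := by
      intro g hg j hj
      rw [jpConj_succ_s10, jpConj_eq_self hg (mem_range.1 hj), if_pos (mem_range.1 hj)]
    unfold hookRow
    rw [prod_congr rfl fun (j : ℕ) hj => congrArg
        (fun c : ℕ => ((Function.update f m (f m + 1) m : ℕ) : ℝ) - (j : ℝ) - 1 + θ * ((c : ℝ) - m - 1) + t) (hc _ hf' j hj),
      prod_congr rfl fun (j : ℕ) hj => congrArg (fun c : ℕ => (f m : ℝ)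
        - (j : ℝ) - 1 + θ * ((c : ℝ) - m - 1) + t) (hc _ hf j hj)]
    rw [Function.update_self, prod_range_succ']
    simp only [Nat.succ_eq_add_one, Ico_self, prod_empty]
    push_cast
    congr 1
    · refine prod_congr rfl fun j _ => ?_
      ring
    · ring
  | succ N hN ih =>
    have hle : (f N : ℝ) ≤ f m := by exact_mod_cast hf (by omega : m ≤ N)
    have hi' : ((m : ℝ) + 1) ≤ N := by exact_mod_cast hN
    have p1 : 0 < θ * ((N : ℝ) - m) + t := by
      have := mul_nonneg hθ.le (show (0 : ℝ) ≤ N - m by linarith); linarith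
    have p2 : 0 < θ * ((N : ℝ) - m - 1) + t := by
      have := mul_nonneg hθ.le (show (0 : ℝ) ≤ N - m - 1 by linarith); linarith
    have hF : (0 : ℝ) ≤ f m := Nat.cast_nonneg _
    have r1 := hookRow_succ_mul_Gamma hθ ht hf (show m < N from hN)
    have r2 := hookRow_succ_mul_Gamma hθ ht hf' (show m < N from hN)
    rw [ih, Function.update_self, Function.update_of_ne (by omega)] at r2
    push_cast at r2
    rw [show (f m : ℝ) + 1 - f N + θ * (N - m) + t = (f m - f N + θ * (N - m) + t) + 1 by ring,
      show (f m : ℝ) + 1 - f N + θ * (N - m - 1) + t = (f m - f N + θ * (N - m - 1) + t) + 1 by ring,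
      show (f m : ℝ) + 1 + (θ * (N - m) + t) = (f m + (θ * (N - m) + t)) + 1 by ring,
      show (f m : ℝ) + 1 + (θ * (N - m - 1) + t) = (f m + (θ * (N - m - 1) + t)) + 1 by ring,
      Real.Gamma_add_one (by linarith), Real.Gamma_add_one (by linarith),
      Real.Gamma_add_one (by linarith), Real.Gamma_add_one (by linarith)] at r2
    have g1 : 0 < Real.Gamma (f m - f N + θ * (N - m) + t) := Real.Gamma_pos_of_pos (by linarith)
    have g2 : 0 < Real.Gamma (f m + (θ * (N - m - 1) + t)) := Real.Gamma_pos_of_pos (by linarith)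
    have q1 : 0 < (f m : ℝ) - f N + θ * (N - m) + t := by linarith
    have q2 : 0 < (f m : ℝ) + (θ * (N - m - 1) + t) := by linarith
    rw [prod_Ico_succ_top hN]
    push_cast
    rw [show θ * ((N : ℝ) + 1 - m - 1) = θ * (N - m) by ring]
    generalize Real.Gamma (f m - f N + θ * (N - m) + t) = G1 at *
    generalize Real.Gamma (f m + (θ * (N - m - 1) + t)) = G2 at *
    generalize Real.Gamma (f m - f N + θ * (N - m - 1) + t) = G3 at *
    generalize Real.Gamma (f m + (θ * (N - m) + t)) = G4 at *
    generalize (∏ k ∈ Ico (m + 1) N, ((f m - f k + θ * (k - m - 1) + t) /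
      (f m - f k + θ * (k - m) + t)) : ℝ) = P at *
    generalize (f m : ℝ) - f N + θ * (N - m) + t = a1 at *
    generalize (f m : ℝ) + (θ * (N - m - 1) + t) = a2 at *
    generalize (f m : ℝ) - f N + θ * (N - m - 1) + t = a3 at *
    generalize (f m : ℝ) + (θ * (N - m) + t) = a4 at *
    have hne : a1 * G1 * (a2 * G2) ≠ 0 := by positivity
    refine mul_right_cancel₀ hne ?_
    have ha : a3 / a1 * a1 = a3 := div_mul_cancel₀ _ q1.ne'
    linear_combination r2 - (a2 * P * a4 * a3) * r1 -
      (hookRow θ t (N + 1) f m * a4 * P * G1 * a2 * G2) * ha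

theorem hookRow_update_of_lt {θ t : ℝ} (hθ : 0 < θ) (ht : 0 < t) {f : ℕ → ℕ} (hf : Antitone f)
    {i m N : ℕ} (hm : m < N) (him : i < m) (hf' : Antitone (Function.update f m (f m + 1))) :
    hookRow θ t N (Function.update f m (f m + 1)) i =
      hookRow θ t N f i * ((f i - f m - 1 + θ * (m - i) + t) /
        (f i - f m - 1 + θ * (m - i - 1) + t)) := by
  have hlt : ∀ k < m, f m < f k := by
    intro k hk
    have := hf' hk.le
    rw [Function.update_self, Function.update_of_ne hk.ne] at this
    omega
  have hc : jpConj N f (f m) = m := jpConj_eq_s10 hm.le hlt fun k hk => hf hk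
  have h1 : ((i : ℝ) + 1) ≤ m := by exact_mod_cast him
  have h2 : ((f m : ℝ) + 1) ≤ f i := by exact_mod_cast hlt i him
  have p2 : 0 ≤ θ * ((m : ℝ) - i - 1) := mul_nonneg hθ.le (by linarith)
  have hden : (f i - f m - 1 + θ * (m - i - 1) + t : ℝ) ≠ 0 := by linarith
  unfold hookRow
  rw [Function.update_of_ne him.ne, ← mul_prod_erase _ _ (mem_range.2 (hlt i him)),
    ← mul_prod_erase (range (f i)) (fun j => ((f i : ℝ) - j - 1 +
      θ * ((jpConj N f j : ℝ) - i - 1) + t)) (mem_range.2 (hlt i him))]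
  rw [prod_congr rfl fun j hj => by
    rw [jpConj_update hm, if_neg (ne_of_mem_erase hj), add_zero]]
  rw [jpConj_update hm, if_pos rfl, hc]
  push_cast
  field_simp
  ring

theorem hookRow_update_of_gt {θ t : ℝ} {f : ℕ → ℕ} (hf : Antitone f)
    {i m N : ℕ} (hm : m < N) (him : m < i) :
    hookRow θ t N (Function.update f m (f m + 1)) i = hookRow θ t N f i := by
  unfold hookRow
  rw [Function.update_of_ne him.ne']
  refine prod_congr rfl fun j hj => ?_
  have h1 := mem_range.1 hj
  have h2 : f i ≤ f m := hf him.le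
  rw [jpConj_update hm, if_neg (by omega), add_zero]

theorem prod_range_erase_eq {N m : ℕ} (hm : m < N) (g : ℕ → ℝ) :
    ∏ k ∈ (range N).erase m, g k = (∏ k ∈ range m, g k) * ∏ k ∈ Ico (m + 1) N, g k := by
  rw [← prod_union]
  · refine prod_congr ?_ fun _ _ => rfl
    ext k
    simp only [mem_erase, mem_range, mem_union, mem_Ico]
    omega
  · rw [disjoint_left]
    intro k
    simp only [mem_range, mem_Ico]
    omega

/-- The anisotropic row coordinate `λ_k - θ k`. -/
noncomputable def rowCoord (θ : ℝ) (f : ℕ → ℕ) (k : ℕ) : ℝ := f k - θ * k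

theorem rowCoord_sub_le {θ : ℝ} (hθ : 0 < θ) {f : ℕ → ℕ} (hf : Antitone f) {i k : ℕ} (h : i < k) :
    θ ≤ rowCoord θ f i - rowCoord θ f k := by
  have h1 : (f k : ℝ) ≤ f i := by exact_mod_cast hf h.le
  have h2 : (i : ℝ) + 1 ≤ k := by exact_mod_cast h
  have h3 := mul_nonneg hθ.le (show (0 : ℝ) ≤ k - i - 1 by linarith)
  unfold rowCoord
  linarith

theorem rowCoord_injective {θ : ℝ} (hθ : 0 < θ) {f : ℕ → ℕ} (hf : Antitone f) :
    Function.Injective (rowCoord θ f) :=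
  (strictAnti_nat_of_succ_lt fun k => by
    have := rowCoord_sub_le hθ hf (Nat.lt_succ_self k)
    simp only [Nat.succ_eq_add_one] at this
    linarith).injective

theorem hookProd_update {θ : ℝ} (hθ : 0 < θ) {f : ℕ → ℕ} (hf : Antitone f) {m N : ℕ} (hm : m < N)
    (hf' : Antitone (Function.update f m (f m + 1))) :
    hookProd θ N (Function.update f m (f m + 1)) =
      hookProd θ N f * ((rowCoord θ f m + θ * N) * (rowCoord θ f m + θ * N + 1 - θ) *
        ∏ k ∈ (range N).erase m,
          ((1 - θ / (rowCoord θ f m + 1 - rowCoord θ f k)) /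
            (1 + θ / (rowCoord θ f m - rowCoord θ f k)))) := by
  unfold hookProd
  rw [← mul_prod_erase _ _ (mem_range.2 hm),
    ← mul_prod_erase (range N) (fun i => hookRow θ θ N f i * hookRow θ 1 N f i) (mem_range.2 hm)]
  rw [prod_range_erase_eq hm, prod_range_erase_eq hm, prod_range_erase_eq hm]
  rw [hookRow_update_self hθ hθ hf hm hf', hookRow_update_self hθ one_pos hf hm hf']
  have e1 : ∏ k ∈ range m, (hookRow θ θ N (Function.update f m (f m + 1)) k *
      hookRow θ 1 N (Function.update f m (f m + 1)) k) =
      (∏ k ∈ range m, (hookRow θ θ N f k * hookRow θ 1 N f k)) *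
      ∏ k ∈ range m, ((1 - θ / (rowCoord θ f m + 1 - rowCoord θ f k)) /
            (1 + θ / (rowCoord θ f m - rowCoord θ f k))) := by
    rw [← prod_mul_distrib]
    refine prod_congr rfl fun k hk => ?_
    have hk' := mem_range.1 hk
    have h1 := rowCoord_sub_le hθ hf' hk'
    have hlt : f m + 1 ≤ f k := by
      have := hf' hk'.le
      rwa [Function.update_self, Function.update_of_ne hk'.ne] at this
    have h2 : ((f m : ℝ) + 1) ≤ f k := by exact_mod_cast hlt
    have h3 : ((k : ℝ) + 1) ≤ m := by exact_mod_cast hk'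
    have h4 := mul_nonneg hθ.le (show (0 : ℝ) ≤ m - k - 1 by linarith)
    rw [hookRow_update_of_lt hθ hθ hf hm hk' hf', hookRow_update_of_lt hθ one_pos hf hm hk' hf']
    unfold rowCoord
    have n1 : (f k - f m - 1 + θ * (m - k - 1) + θ : ℝ) ≠ 0 := by linarith
    have n2 : (f k - f m - 1 + θ * (m - k - 1) + 1 : ℝ) ≠ 0 := by linarith
    have n3 : (f m - θ * m + 1 - (f k - θ * k) : ℝ) ≠ 0 := by linarith
    have n4 : (f m - θ * m - (f k - θ * k) : ℝ) ≠ 0 := by linarith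
    have n5 : (f m - θ * m - (f k - θ * k) + θ : ℝ) ≠ 0 := by linarith
    have n6 : (1 + θ / (f m - θ * m - (f k - θ * k)) : ℝ) ≠ 0 := by
      rw [one_add_div n4]
      exact div_ne_zero n5 n4
    rw [mul_mul_mul_comm]
    congr 1
    rw [one_add_div n4, one_sub_div n3, div_div_div_eq, div_mul_div_comm,
      div_eq_div_iff (mul_ne_zero n1 n2) (mul_ne_zero n3 n5)]
    ring
  have e2 : ∏ k ∈ Ico (m + 1) N, (hookRow θ θ N (Function.update f m (f m + 1)) k *
      hookRow θ 1 N (Function.update f m (f m + 1)) k) =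
      ∏ k ∈ Ico (m + 1) N, (hookRow θ θ N f k * hookRow θ 1 N f k) := by
    refine prod_congr rfl fun k hk => ?_
    have := (mem_Ico.1 hk).1
    rw [hookRow_update_of_gt hf hm (by omega), hookRow_update_of_gt hf hm (by omega)]
  have e3 : (∏ k ∈ Ico (m + 1) N, (f m - f k + θ * (k - m - 1) + θ) /
        (f m - f k + θ * (k - m) + θ) : ℝ) *
      ∏ k ∈ Ico (m + 1) N, (f m - f k + θ * (k - m - 1) + 1) / (f m - f k + θ * (k - m) + 1) =
      ∏ k ∈ Ico (m + 1) N, ((1 - θ / (rowCoord θ f m + 1 - rowCoord θ f k)) /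
            (1 + θ / (rowCoord θ f m - rowCoord θ f k))) := by
    rw [← prod_mul_distrib]
    refine prod_congr rfl fun k hk => ?_
    have hk' : m < k := (mem_Ico.1 hk).1
    have h1 := rowCoord_sub_le hθ hf hk'
    unfold rowCoord at h1 ⊢
    have n1 : (f m - f k + θ * (k - m) + θ : ℝ) ≠ 0 := by linarith
    have n2 : (f m - f k + θ * (k - m) + 1 : ℝ) ≠ 0 := by linarith
    have n3 : (f m - θ * m + 1 - (f k - θ * k) : ℝ) ≠ 0 := by linarith
    have n4 : (f m - θ * m - (f k - θ * k) : ℝ) ≠ 0 := by linarith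
    have n5 : (f m - θ * m - (f k - θ * k) + θ : ℝ) ≠ 0 := by linarith
    rw [one_add_div n4, one_sub_div n3, div_div_div_eq, div_mul_div_comm,
      div_eq_div_iff (mul_ne_zero n1 n2) (mul_ne_zero n3 n5)]
    ring
  rw [e1, e2, ← e3]
  unfold rowCoord
  ring

theorem sum_up_weights {θ : ℝ} (hθ : 0 < θ) {f : ℕ → ℕ} (hf : Antitone f) {n : ℕ}
    (hn : f n = 0) :
    ∑ i ∈ range (n + 1), (∏ k ∈ (range (n + 1)).erase i,
      (1 + θ / (rowCoord θ f i - rowCoord θ f k))) / (rowCoord θ f i + θ * (n + 1 : ℕ)) = 1 / θ := by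
  have h0 : f (n + 1) = 0 := Nat.le_zero.1 (hn ▸ hf (Nat.le_succ n))
  have hw : rowCoord θ f (n + 1) = - (θ * (n + 1 : ℕ)) := by simp [rowCoord, h0]
  have hinj := rowCoord_injective hθ hf
  have h := prod_one_sub_div_eq_one_sub_sum (-θ) (rowCoord θ f) hinj (range (n + 1))
    (rowCoord θ f (n + 1)) fun i hi h => (mem_range.1 hi).ne (hinj h).symm
  rw [prod_eq_zero (self_mem_range_succ n)] at h
  · rw [hw] at h
    have e : ∀ i, (∏ k ∈ (range (n + 1)).erase i,
        (1 + θ / (rowCoord θ f i - rowCoord θ f k))) / (rowCoord θ f i + θ * (n + 1 : ℕ)) =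
        -((∏ k ∈ (range (n + 1)).erase i, (1 - -θ / (rowCoord θ f i - rowCoord θ f k))) /
          (-(θ * (n + 1 : ℕ)) - rowCoord θ f i)) := by
      intro i
      simp only [neg_div, sub_neg_eq_add]
      rw [← div_neg]
      congr 1
      ring
    rw [sum_congr rfl fun i _ => e i, sum_neg_distrib, eq_div_iff hθ.ne']
    linarith
  · have : rowCoord θ f (n + 1) - rowCoord θ f n = -θ := by
      unfold rowCoord
      rw [h0, hn]
      push_cast
      ring
    rw [this, div_self (by linarith), sub_self]

theorem sum_down_weights {θ : ℝ} (hθ : 0 < θ) {f : ℕ → ℕ} (hf : Antitone f) (N : ℕ) :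
    ∑ i ∈ range N, (rowCoord θ f i + θ * N - θ) * ∏ k ∈ (range N).erase i,
      (1 - θ / (rowCoord θ f i - rowCoord θ f k)) = ∑ i ∈ range N, (f i : ℝ) := by
  obtain ⟨h1, h2⟩ := sum_prod_one_sub_div θ (rowCoord θ f) (rowCoord_injective hθ hf) (range N)
  simp only [add_sub_assoc, add_mul, sum_add_distrib, ← mul_sum, h1, h2, card_range]
  have h3 : ∑ i ∈ range N, (i : ℝ) = N * (N - 1) / 2 := by
    induction N with
    | zero => simp
    | succ N ih =>
      have := ih (sum_prod_one_sub_div θ (rowCoord θ f) (rowCoord_injective hθ hf) (range N)).1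
        (sum_prod_one_sub_div θ (rowCoord θ f) (rowCoord_injective hθ hf) (range N)).2
      rw [sum_range_succ, this]
      push_cast
      ring
  simp only [rowCoord, sum_sub_distrib, ← mul_sum, h3]
  ring

theorem finite_setOf_partition (n : ℕ) :
    {f : ℕ → ℕ | Antitone f ∧ (∑ i ∈ range n, f i) = n ∧ f n = 0}.Finite := by
  refine Set.Finite.of_injOn (f := fun (f : ℕ → ℕ) (i : Fin n) => f i)
    (t := Set.Iic fun _ => n) ?_ ?_ (Set.finite_Iic _)
  · rintro f ⟨_, hs, _⟩ i
    calc f i ≤ ∑ i ∈ range n, f i :=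
          single_le_sum (f := f) (fun _ _ => Nat.zero_le _) (mem_range.2 i.2)
      _ = n := hs
  · rintro f ⟨hf, _, hfn⟩ g ⟨hg, _, hgn⟩ h
    funext i
    rcases lt_or_ge i n with hi | hi
    · exact congrFun h ⟨i, hi⟩
    · have h1 := hf hi
      have h2 := hg hi
      omega

/-- The partitions of `n`, as antitone sequences of parts. -/
noncomputable def partitionSeqs (n : ℕ) : Finset (ℕ → ℕ) := (finite_setOf_partition n).toFinset

theorem mem_partitionSeqs {n : ℕ} {f : ℕ → ℕ} :
    f ∈ partitionSeqs n ↔ Antitone f ∧ (∑ i ∈ range n, f i) = n ∧ f n = 0 := by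
  simp [partitionSeqs]

theorem rowCoord_update_self (θ : ℝ) (f : ℕ → ℕ) (m : ℕ) :
    rowCoord θ (Function.update f m (f m + 1)) m = rowCoord θ f m + 1 := by
  simp only [rowCoord, Function.update_self]
  push_cast
  ring

theorem rowCoord_update_of_ne (θ : ℝ) (f : ℕ → ℕ) {m k : ℕ} (h : k ≠ m) (a : ℕ) :
    rowCoord θ (Function.update f m a) k = rowCoord θ f k := by
  simp only [rowCoord, Function.update_of_ne h]

theorem antitone_update_sub_one {f : ℕ → ℕ} (hf : Antitone f) {i : ℕ} (hi : f (i + 1) < f i) :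
    Antitone (Function.update f i (f i - 1)) := by
  refine antitone_nat_of_succ_le fun k => ?_
  have h1 := hf (Nat.le_succ k)
  simp only [Function.update_apply]
  split_ifs with h2 h3 h3
  · omega
  · subst h2
    simp only [Nat.succ_eq_add_one] at h1
    omega
  · subst h3
    omega
  · exact h1

theorem update_mem_partitionSeqs_succ {n : ℕ} {f : ℕ → ℕ} (hf : f ∈ partitionSeqs n) {i : ℕ}
    (hi : i < n + 1) (h : Antitone (Function.update f i (f i + 1))) :
    Function.update f i (f i + 1) ∈ partitionSeqs (n + 1) := by
  obtain ⟨h1, h2, h3⟩ := mem_partitionSeqs.1 hf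
  refine mem_partitionSeqs.2 ⟨h, ?_, ?_⟩
  · have h4 : ∑ k ∈ range (n + 1), f k = n := by rw [sum_range_succ, h2, h3, add_zero]
    rw [← add_sum_erase _ _ (mem_range.2 hi)] at h4 ⊢
    rw [Function.update_self,
      sum_congr rfl fun k hk => Function.update_of_ne (ne_of_mem_erase hk) _ _]
    omega
  · rw [Function.update_of_ne (by omega)]
    have := h1 (Nat.le_succ n)
    simp only [Nat.succ_eq_add_one] at this
    omega

theorem update_mem_partitionSeqs_pred {n : ℕ} {f : ℕ → ℕ} (hf : f ∈ partitionSeqs (n + 1)) {i : ℕ}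
    (hi : i < n + 1) (h : f (i + 1) < f i) :
    Function.update f i (f i - 1) ∈ partitionSeqs n := by
  obtain ⟨h1, h2, h3⟩ := mem_partitionSeqs.1 hf
  have ha := antitone_update_sub_one h1 h
  have hs : ∑ k ∈ range (n + 1), Function.update f i (f i - 1) k = n := by
    rw [← add_sum_erase _ _ (mem_range.2 hi)] at h2 ⊢
    rw [Function.update_self,
      sum_congr rfl fun k hk => Function.update_of_ne (ne_of_mem_erase hk) _ _]
    omega
  have h0 : Function.update f i (f i - 1) n = 0 := by
    by_contra hne
    have : ∑ _k ∈ range (n + 1), 1 ≤ ∑ k ∈ range (n + 1), Function.update f i (f i - 1) k :=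
      sum_le_sum fun k hk => (Nat.one_le_iff_ne_zero.2 hne).trans
        (ha (Nat.lt_succ_iff.1 (mem_range.1 hk)))
    rw [hs] at this
    simp at this
  refine mem_partitionSeqs.2 ⟨ha, ?_, h0⟩
  rw [sum_range_succ, h0, add_zero] at hs
  exact hs

theorem down_weight_div_hookProd {θ : ℝ} (hθ : 0 < θ) {f : ℕ → ℕ} (hf : Antitone f) {m N : ℕ}
    (hm : m < N) (hf' : Antitone (Function.update f m (f m + 1))) :
    ((rowCoord θ (Function.update f m (f m + 1)) m + θ * N - θ) * ∏ k ∈ (range N).erase m,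
      (1 - θ / (rowCoord θ (Function.update f m (f m + 1)) m -
        rowCoord θ (Function.update f m (f m + 1)) k))) /
        hookProd θ N (Function.update f m (f m + 1)) =
    ((∏ k ∈ (range N).erase m, (1 + θ / (rowCoord θ f m - rowCoord θ f k))) /
      (rowCoord θ f m + θ * N)) / hookProd θ N f := by
  have e : ∏ k ∈ (range N).erase m, (1 - θ / (rowCoord θ (Function.update f m (f m + 1)) m -
        rowCoord θ (Function.update f m (f m + 1)) k)) =
      ∏ k ∈ (range N).erase m, (1 - θ / (rowCoord θ f m + 1 - rowCoord θ f k)) := by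
    refine prod_congr rfl fun k hk => ?_
    rw [rowCoord_update_self, rowCoord_update_of_ne _ _ (ne_of_mem_erase hk)]
  have hH := hookProd_pos hθ hf (N := N)
  have hH' := hookProd_pos hθ hf' (N := N)
  have hK := hookProd_update hθ hf hm hf'
  rw [prod_div_distrib] at hK
  rw [e, rowCoord_update_self, hK]
  rw [hK] at hH'
  generalize ∏ k ∈ (range N).erase m, (1 - θ / (rowCoord θ f m + 1 - rowCoord θ f k)) = C at *
  generalize ∏ k ∈ (range N).erase m, (1 + θ / (rowCoord θ f m - rowCoord θ f k)) = P at *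
  generalize hookProd θ N f = H at *
  have hne := hH'.ne'
  have n1 : rowCoord θ f m + θ * N ≠ 0 := by rintro h; simp [h] at hne
  have n2 : rowCoord θ f m + θ * N + 1 - θ ≠ 0 := by rintro h; simp [h] at hne
  have n3 : C ≠ 0 := by rintro h; simp [h] at hne
  have n4 : P ≠ 0 := by rintro h; simp [h] at hne
  rw [show rowCoord θ f m + 1 + θ * N - θ = rowCoord θ f m + θ * N + 1 - θ by ring]
  field_simp

theorem lt_of_down_weight_ne_zero {θ : ℝ} {f : ℕ → ℕ} (hf : Antitone f) {i N : ℕ} (hi : i < N)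
    (hN : f N = 0) (h : (rowCoord θ f i + θ * N - θ) * ∏ k ∈ (range N).erase i,
      (1 - θ / (rowCoord θ f i - rowCoord θ f k)) ≠ 0) (hθ : 0 < θ) : f (i + 1) < f i := by
  by_contra hlt
  have heq : f (i + 1) = f i := le_antisymm (hf (Nat.le_succ i)) (not_lt.1 hlt)
  apply h
  rcases Nat.lt_or_ge (i + 1) N with h1 | h1
  · refine mul_eq_zero_of_right _ (prod_eq_zero
      (mem_erase.2 ⟨Nat.succ_ne_self i, mem_range.2 h1⟩) ?_)
    have : rowCoord θ f i - rowCoord θ f (i + 1) = θ := by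
      simp only [rowCoord, heq]; push_cast; ring
    rw [Nat.succ_eq_add_one, this, div_self hθ.ne', sub_self]
  · obtain rfl : N = i + 1 := by omega
    refine mul_eq_zero_of_left ?_ _
    simp only [rowCoord, ← heq, hN]; push_cast; ring

theorem antitone_of_up_weight_ne_zero {θ : ℝ} {f : ℕ → ℕ} (hf : Antitone f) {i N : ℕ} (hi : i < N)
    (h : ∏ k ∈ (range N).erase i, (1 + θ / (rowCoord θ f i - rowCoord θ f k)) ≠ 0) (hθ : 0 < θ) :
    Antitone (Function.update f i (f i + 1)) := by
  refine antitone_nat_of_succ_le fun k => ?_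
  have h1 := hf (Nat.le_succ k)
  simp only [Function.update_apply]
  split_ifs with h2 h3 h3
  · omega
  · subst h2
    by_contra hlt
    have heq : f (k + 1) = f k := by simp only [Nat.succ_eq_add_one] at h1; omega
    refine h (prod_eq_zero (mem_erase.2 ⟨h3, mem_range.2 (by omega)⟩) ?_)
    have : rowCoord θ f (k + 1) - rowCoord θ f k = -θ := by
      simp only [rowCoord, heq]; push_cast; ring
    rw [this, div_neg, div_self hθ.ne', add_neg_cancel]
  · subst h3
    simp only [Nat.succ_eq_add_one] at h1
    omega
  · exact h1

theorem sum_inv_hookProd_succ {θ : ℝ} (hθ : 0 < θ) (n : ℕ) :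
    ((n + 1 : ℕ) : ℝ) * ∑ f ∈ partitionSeqs (n + 1), 1 / hookProd θ (n + 1) f =
      1 / θ * ∑ f ∈ partitionSeqs n, 1 / hookProd θ n f := by
  classical
  have hL : ((n + 1 : ℕ) : ℝ) * ∑ f ∈ partitionSeqs (n + 1), 1 / hookProd θ (n + 1) f =
      ∑ p ∈ partitionSeqs (n + 1) ×ˢ range (n + 1),
        ((rowCoord θ p.1 p.2 + θ * (n + 1 : ℕ) - θ) * ∏ k ∈ (range (n + 1)).erase p.2,
          (1 - θ / (rowCoord θ p.1 p.2 - rowCoord θ p.1 k))) / hookProd θ (n + 1) p.1 := by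
    rw [sum_product, mul_sum]
    refine sum_congr rfl fun f hf => ?_
    obtain ⟨h1, h2, h3⟩ := mem_partitionSeqs.1 hf
    simp only
    rw [← sum_div, sum_down_weights hθ h1 (n + 1), mul_one_div]
    congr 1
    exact_mod_cast h2.symm
  have hR : 1 / θ * ∑ f ∈ partitionSeqs n, 1 / hookProd θ n f =
      ∑ p ∈ partitionSeqs n ×ˢ range (n + 1), ((∏ k ∈ (range (n + 1)).erase p.2,
        (1 + θ / (rowCoord θ p.1 p.2 - rowCoord θ p.1 k))) /
          (rowCoord θ p.1 p.2 + θ * (n + 1 : ℕ))) / hookProd θ (n + 1) p.1 := by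
    rw [sum_product, mul_sum]
    refine sum_congr rfl fun f hf => ?_
    obtain ⟨h1, h2, h3⟩ := mem_partitionSeqs.1 hf
    simp only
    rw [← sum_div, sum_up_weights hθ h1 h3, mul_one_div, hookProd_of_le θ h1 h3 (Nat.le_succ n)]
  rw [hL, hR]
  rw [← sum_filter_of_ne (p := fun p : (ℕ → ℕ) × ℕ => p.1 (p.2 + 1) < p.1 p.2)
      (s := partitionSeqs (n + 1) ×ˢ range (n + 1)),
    ← sum_filter_of_ne (p := fun p : (ℕ → ℕ) × ℕ =>
      Antitone (Function.update p.1 p.2 (p.1 p.2 + 1))) (s := partitionSeqs n ×ˢ range (n + 1))]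
  · have key : ∀ p : (ℕ → ℕ) × ℕ, p.1 (p.2 + 1) < p.1 p.2 →
        Function.update (Function.update p.1 p.2 (p.1 p.2 - 1)) p.2
          (Function.update p.1 p.2 (p.1 p.2 - 1) p.2 + 1) = p.1 := by
      intro p hp
      rw [Function.update_self, Function.update_idem, Nat.sub_add_cancel (by omega),
        Function.update_eq_self]
    refine sum_nbij' (fun p => (Function.update p.1 p.2 (p.1 p.2 - 1), p.2))
      (fun p => (Function.update p.1 p.2 (p.1 p.2 + 1), p.2)) ?_ ?_ ?_ ?_ ?_
    · intro p hp
      obtain ⟨hp1, hp2⟩ := mem_filter.1 hp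
      obtain ⟨hp3, hp4⟩ := mem_product.1 hp1
      refine mem_filter.2 ⟨mem_product.2
        ⟨update_mem_partitionSeqs_pred hp3 (mem_range.1 hp4) hp2, hp4⟩, ?_⟩
      simp only
      rw [key p hp2]
      exact (mem_partitionSeqs.1 hp3).1
    · intro p hp
      obtain ⟨hp1, hp2⟩ := mem_filter.1 hp
      obtain ⟨hp3, hp4⟩ := mem_product.1 hp1
      refine mem_filter.2 ⟨mem_product.2
        ⟨update_mem_partitionSeqs_succ hp3 (mem_range.1 hp4) hp2, hp4⟩, ?_⟩
      simp only
      rw [Function.update_self, Function.update_of_ne (Nat.succ_ne_self _)]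
      exact Nat.lt_succ_of_le ((mem_partitionSeqs.1 hp3).1 (Nat.le_succ _))
    · intro p hp
      simp only
      rw [key p (mem_filter.1 hp).2]
    · intro p hp
      simp
    · intro p hp
      obtain ⟨hp1, hp2⟩ := mem_filter.1 hp
      obtain ⟨hp3, hp4⟩ := mem_product.1 hp1
      have h1 := (mem_partitionSeqs.1 hp3).1
      have := down_weight_div_hookProd hθ (antitone_update_sub_one h1 hp2) (mem_range.1 hp4)
        (by rw [key p hp2]; exact h1)
      rw [key p hp2] at this
      exact this
  · intro p hp hne
    obtain ⟨hp3, hp4⟩ := mem_product.1 hp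
    exact antitone_of_up_weight_ne_zero (mem_partitionSeqs.1 hp3).1 (mem_range.1 hp4)
      (fun h => hne (by rw [h, zero_div, zero_div])) hθ
  · intro p hp hne
    obtain ⟨hp3, hp4⟩ := mem_product.1 hp
    obtain ⟨h1, _, h2⟩ := mem_partitionSeqs.1 hp3
    exact lt_of_down_weight_ne_zero h1 (mem_range.1 hp4) h2
      (fun h => hne (by rw [h, zero_div])) hθ

/-- The total mass identity for the Jack–Plancherel measure. -/
theorem sum_inv_hookProd {θ : ℝ} (hθ : 0 < θ) (n : ℕ) :
    ∑ f ∈ partitionSeqs n, 1 / hookProd θ n f = 1 / (n.factorial * θ ^ n) := by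
  induction n with
  | zero =>
    have : partitionSeqs 0 = {fun _ => 0} := by
      ext f
      rw [mem_partitionSeqs, mem_singleton]
      constructor
      · rintro ⟨h1, _, h2⟩
        funext i
        exact Nat.le_zero.1 (h2 ▸ h1 (Nat.zero_le i))
      · rintro rfl
        exact ⟨antitone_const, by simp, rfl⟩
    simp [this, hookProd]
  | succ n ih =>
    have h := sum_inv_hookProd_succ hθ n
    have hn : ((n + 1 : ℕ) : ℝ) ≠ 0 := by positivity
    rw [ih] at h
    rw [← mul_right_inj' hn, h, Nat.factorial_succ, pow_succ]
    push_cast at hn ⊢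
    have : (n.factorial : ℝ) ≠ 0 := by positivity
    field_simp

theorem jpConj_succ_of_lt {f : ℕ → ℕ} {j : ℕ} (hj : j < f 0) (N : ℕ) :
    jpConj (N + 1) f j = jpConj N (fun i => f (i + 1)) j + 1 := by
  unfold jpConj
  rw [card_filter, card_filter, sum_range_succ', if_pos hj]

theorem hookRow_succ_row {f : ℕ → ℕ} (hf : Antitone f) (θ t : ℝ) (N i : ℕ) :
    hookRow θ t (N + 1) f (i + 1) = hookRow θ t N (fun i => f (i + 1)) i := by
  unfold hookRow
  refine prod_congr rfl fun j hj => ?_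
  rw [jpConj_succ_of_lt ((mem_range.1 hj).trans_le (hf (Nat.zero_le _)))]
  push_cast
  ring

theorem prod_range_add_le_hookRow_zero {θ t : ℝ} (hθ : 0 < θ) (ht : 0 < t) {f : ℕ → ℕ}
    (hf : Antitone f) (N : ℕ) :
    ∏ a ∈ range (f 0), ((a : ℝ) + t) ≤ hookRow θ t (N + 1) f 0 := by
  unfold hookRow
  rw [← prod_range_reflect]
  refine prod_le_prod (fun j _ => by positivity) fun j hj => ?_
  have hj' := mem_range.1 hj
  have h1 : ((0 + 1 : ℕ) : ℝ) ≤ jpConj (N + 1) f j := by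
    exact_mod_cast le_jpConj hf (Nat.succ_pos N) hj'
  have h2 : ((f 0 - 1 - j : ℕ) : ℝ) = f 0 - j - 1 := by
    rw [Nat.sub_sub, Nat.cast_sub (by omega)]
    push_cast
    ring
  push_cast at h1
  have h3 := mul_nonneg hθ.le (show (0 : ℝ) ≤ jpConj (N + 1) f j - 0 - 1 by linarith)
  rw [h2]
  push_cast
  linarith

theorem prod_mul_hookProd_le {θ : ℝ} (hθ : 0 < θ) {f : ℕ → ℕ} (hf : Antitone f) (N : ℕ) :
    ((∏ a ∈ range (f 0), ((a : ℝ) + θ)) * (f 0).factorial) *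
      hookProd θ N (fun i => f (i + 1)) ≤ hookProd θ (N + 1) f := by
  have hg : Antitone fun i => f (i + 1) := fun a b h => hf (Nat.succ_le_succ h)
  unfold hookProd
  rw [prod_range_succ', mul_comm]
  simp only [hookRow_succ_row hf]
  refine mul_le_mul_of_nonneg_left ?_ (hookProd_pos hθ hg).le
  have h1 := prod_range_add_le_hookRow_zero hθ hθ hf N
  have h2 := prod_range_add_le_hookRow_zero hθ one_pos hf N
  have h3 : ∏ a ∈ range (f 0), ((a : ℝ) + 1) = (f 0).factorial := by
    rw [← prod_range_add_one_eq_factorial]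
    push_cast
    rfl
  rw [h3] at h2
  exact mul_le_mul h1 h2 (by positivity) (hookRow_pos hθ hθ hf (Nat.succ_pos N)).le

theorem tail_mem_partitionSeqs {n : ℕ} {f : ℕ → ℕ} (hf : f ∈ partitionSeqs n) (h0 : 1 ≤ f 0) :
    (fun i => f (i + 1)) ∈ partitionSeqs (n - f 0) ∧ f 0 ≤ n := by
  obtain ⟨h1, h2, h3⟩ := mem_partitionSeqs.1 hf
  have hg : Antitone fun i => f (i + 1) := fun a b h => h1 (Nat.succ_le_succ h)
  have hs : ∑ i ∈ range n, f (i + 1) + f 0 = n := by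
    rw [← sum_range_succ', sum_range_succ, h2, h3, add_zero]
  have hz : f (n - f 0 + 1) = 0 := by
    by_contra hne
    have h4 : ∑ _k ∈ range (n - f 0 + 1), 1 ≤ ∑ k ∈ range (n - f 0 + 1), f (k + 1) :=
      sum_le_sum fun k hk => (Nat.one_le_iff_ne_zero.2 hne).trans
        (h1 (by have := mem_range.1 hk; omega))
    have h5 : ∑ k ∈ range (n - f 0 + 1), f (k + 1) ≤ ∑ k ∈ range n, f (k + 1) :=
      sum_le_sum_of_subset (range_subset_range.2 (by omega))
    simp only [sum_const, card_range, smul_eq_mul, mul_one] at h4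
    omega
  refine ⟨mem_partitionSeqs.2 ⟨hg, ?_, hz⟩, by omega⟩
  have h6 : ∑ i ∈ range (n - f 0), f (i + 1) = ∑ i ∈ range n, f (i + 1) := by
    refine sum_subset (range_subset_range.2 (by omega)) fun k _ hk => ?_
    have : n - f 0 ≤ k := by simpa using hk
    exact Nat.le_zero.1 (hz ▸ h1 (Nat.succ_le_succ this))
  rw [h6]
  omega

theorem sum_weight_first_row_le {θ : ℝ} (hθ : 0 < θ) {n k : ℕ} (hk : 1 ≤ k) :
    ∑ f ∈ partitionSeqs n with f 0 = k, jackPlancherelWeight θ n f ≤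
      (n : ℝ) ^ k * θ ^ k / ((∏ a ∈ range k, ((a : ℝ) + θ)) * k.factorial) := by
  classical
  rcases Nat.lt_or_ge n k with hnk | hkn
  · rw [filter_eq_empty_iff.2, sum_empty]
    · positivity
    · rintro f hf rfl
      exact absurd (tail_mem_partitionSeqs hf hk).2 (by omega)
  set D : ℝ := (∏ a ∈ range k, ((a : ℝ) + θ)) * k.factorial with hD
  have hDpos : 0 < D := by
    rw [hD]
    have : 0 < ∏ a ∈ range k, ((a : ℝ) + θ) := prod_pos fun a _ => by positivity
    positivity
  have hstep : ∀ f ∈ {f ∈ partitionSeqs n | f 0 = k}, jackPlancherelWeight θ n f ≤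
      (n.factorial * θ ^ n / D) * (1 / hookProd θ (n - k) fun i => f (i + 1)) := by
    intro f hf
    obtain ⟨hf1, rfl⟩ := mem_filter.1 hf
    obtain ⟨hg, -⟩ := tail_mem_partitionSeqs hf1 hk
    obtain ⟨h1, h2, h3⟩ := mem_partitionSeqs.1 hf1
    obtain ⟨g1, g2, g3⟩ := mem_partitionSeqs.1 hg
    have hb := prod_mul_hookProd_le hθ h1 n
    rw [hookProd_of_le θ g1 g3 (Nat.sub_le _ _), hookProd_of_le θ h1 h3 (Nat.le_succ n)] at hb
    have hp := hookProd_pos hθ g1 (N := n - f 0)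
    rw [jackPlancherelWeight_eq, div_mul_div_comm, mul_one]
    exact div_le_div_of_nonneg_left (by positivity) (by positivity) hb
  have hinj : Set.InjOn (fun (f : ℕ → ℕ) (i : ℕ) => f (i + 1))
      ({f ∈ partitionSeqs n | f 0 = k} : Finset (ℕ → ℕ)) := by
    intro f hf g hg h
    funext i
    cases i with
    | zero => rw [(mem_filter.1 hf).2, (mem_filter.1 hg).2]
    | succ i => exact congrFun h i
  calc ∑ f ∈ partitionSeqs n with f 0 = k, jackPlancherelWeight θ n f
      ≤ ∑ f ∈ partitionSeqs n with f 0 = k,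
          (n.factorial * θ ^ n / D) * (1 / hookProd θ (n - k) fun i => f (i + 1)) :=
        sum_le_sum hstep
    _ = (n.factorial * θ ^ n / D) * ∑ g ∈ ({f ∈ partitionSeqs n | f 0 = k}).image
          (fun (f : ℕ → ℕ) (i : ℕ) => f (i + 1)), 1 / hookProd θ (n - k) g := by
        rw [sum_image hinj, mul_sum]
    _ ≤ (n.factorial * θ ^ n / D) * ∑ g ∈ partitionSeqs (n - k), 1 / hookProd θ (n - k) g := by
        refine mul_le_mul_of_nonneg_left (sum_le_sum_of_subset_of_nonneg ?_ ?_) (by positivity)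
        · intro g hg
          obtain ⟨f, hf, rfl⟩ := mem_image.1 hg
          obtain ⟨hf1, rfl⟩ := mem_filter.1 hf
          exact (tail_mem_partitionSeqs hf1 hk).1
        · intro g hg _
          exact one_div_nonneg.2 (hookProd_pos hθ (mem_partitionSeqs.1 hg).1).le
    _ = ((n.factorial : ℝ) / (n - k).factorial) * θ ^ k / D := by
        rw [sum_inv_hookProd hθ]
        have : θ ^ n = θ ^ k * θ ^ (n - k) := by rw [← pow_add, Nat.add_sub_cancel' hkn]
        rw [this]
        field_simp
    _ ≤ (n : ℝ) ^ k * θ ^ k / D := by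
        have h1 : (n.factorial : ℝ) ≤ n ^ k * (n - k).factorial := by
          have h2 := Nat.factorial_mul_descFactorial hkn
          have h3 := Nat.descFactorial_le_pow n k
          have : n.factorial ≤ n ^ k * (n - k).factorial := by
            rw [← h2, mul_comm]
            exact Nat.mul_le_mul_right _ h3
          exact_mod_cast this
        have h4 : (n.factorial : ℝ) / (n - k).factorial ≤ n ^ k :=
          (div_le_iff₀ (by positivity)).2 h1
        gcongr

theorem pow_div_prod_le {θ : ℝ} (hθ : 0 < θ) (n : ℕ) {k : ℕ} (hk : 1 ≤ k) :
    (n : ℝ) ^ k * θ ^ k / ((∏ a ∈ range k, ((a : ℝ) + θ)) * k.factorial) ≤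
      1 / θ * (θ * Real.exp 3 * n / k ^ 2) ^ k := by
  obtain ⟨m, rfl⟩ : ∃ m, k = m + 1 := ⟨k - 1, by omega⟩
  set K : ℝ := ((m + 1 : ℕ) : ℝ) with hK
  have hKpos : 0 < K := by positivity
  have h1 : θ * (m + 1).factorial ≤ K * ∏ a ∈ range (m + 1), ((a : ℝ) + θ) := by
    have h2 : (m.factorial : ℝ) ≤ ∏ a ∈ range m, (((a + 1 : ℕ) : ℝ) + θ) := by
      rw [← prod_range_add_one_eq_factorial]
      push_cast
      exact prod_le_prod (fun _ _ => by positivity) fun _ _ => by linarith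
    rw [prod_range_succ', Nat.factorial_succ]
    push_cast at h2 ⊢
    have hK' : (m : ℝ) + 1 = K := by rw [hK]; push_cast; ring
    rw [hK', zero_add]
    have := mul_le_mul_of_nonneg_left h2 (show 0 ≤ θ * K by positivity)
    linarith
  have h3 : K ^ (m + 1) ≤ Real.exp K * (m + 1).factorial :=
    (div_le_iff₀ (by positivity)).1 (Real.pow_div_factorial_le_exp K hKpos.le (m + 1))
  have h4 : K ≤ Real.exp K := by linarith [Real.add_one_le_exp K]
  have h5 : Real.exp 3 ^ (m + 1) = Real.exp K * Real.exp K * Real.exp K := by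
    rw [← Real.exp_nat_mul, ← Real.exp_add, ← Real.exp_add, ← hK]
    congr 1
    ring
  set P := ∏ a ∈ range (m + 1), ((a : ℝ) + θ) with hP
  have hPpos : 0 < P := prod_pos fun a _ => by positivity
  set F : ℝ := ((m + 1).factorial : ℝ) with hF
  have hFpos : 0 < F := by positivity
  have hE := Real.exp_pos K
  have main : θ * (K ^ (m + 1)) ^ 2 ≤ Real.exp K * Real.exp K * Real.exp K * (P * F) := by
    calc θ * (K ^ (m + 1)) ^ 2 ≤ θ * (Real.exp K * F) ^ 2 := by gcongr
      _ = Real.exp K * Real.exp K * F * (θ * F) := by ring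
      _ ≤ Real.exp K * Real.exp K * F * (K * P) := by gcongr
      _ ≤ Real.exp K * Real.exp K * F * (Real.exp K * P) := by gcongr
      _ = _ := by ring
  rw [div_pow, mul_pow, mul_pow, h5, one_div_mul_eq_div, div_div,
    div_le_div_iff₀ (by positivity) (by positivity)]
  have := mul_le_mul_of_nonneg_left main (show 0 ≤ (n : ℝ) ^ (m + 1) * θ ^ (m + 1) by positivity)
  calc _ = (n : ℝ) ^ (m + 1) * θ ^ (m + 1) * (θ * (K ^ (m + 1)) ^ 2) := by ring
    _ ≤ _ := this
    _ = _ := by ring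

/-- Fix `θ > 0` and `A₁ > 0`.  There exist constants `b₁, B₁ > 0` depending only on `θ` and
`A₁` such that for all `n ≥ 1` and all `u ≥ b₁`, the Jack–Plancherel measure satisfies
`M^{(n)}_θ(λ₁ ≥ u√n) ≤ B₁·e^{−A₁·u√n}`. -/
theorem jackPlancherel_first_row_tail_bound (θ A₁ : ℝ) (hθ : 0 < θ) (hA₁ : 0 < A₁) :
    ∃ b₁ B₁ : ℝ, 0 < b₁ ∧ 0 < B₁ ∧
      ∀ n : ℕ, 1 ≤ n → ∀ u : ℝ, b₁ ≤ u →
        (∑' f : {f : ℕ → ℕ // Antitone f},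
            if (∑ i ∈ Finset.range n, f.1 i) = n ∧ f.1 n = 0 ∧ u * Real.sqrt n ≤ (f.1 0 : ℝ) then
              jackPlancherelWeight θ n f.1 else 0)
          ≤ B₁ * Real.exp (-A₁ * u * Real.sqrt n) := by
  classical
  set b : ℝ := Real.sqrt (θ * Real.exp (A₁ + 4)) with hb
  have hbpos : 0 < b := Real.sqrt_pos.2 (by positivity)
  have hb2 : b ^ 2 = θ * Real.exp (A₁ + 4) := Real.sq_sqrt (by positivity)
  have he : Real.exp (-1) < 1 := Real.exp_lt_one_iff.2 (by norm_num)
  set C : ℝ := (1 - Real.exp (-1))⁻¹ with hC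
  have hCpos : 0 < C := inv_pos.2 (by linarith)
  refine ⟨b, 1 / θ * C, hbpos, by positivity, fun n hn u hu => ?_⟩
  set T : ℝ := u * Real.sqrt n with hT
  have hn' : (0 : ℝ) < n := by exact_mod_cast hn
  have hTpos : 0 < T := mul_pos (hbpos.trans_le hu) (Real.sqrt_pos.2 hn')
  have hsum : (∑' f : {f : ℕ → ℕ // Antitone f},
      if (∑ i ∈ Finset.range n, f.1 i) = n ∧ f.1 n = 0 ∧ T ≤ (f.1 0 : ℝ) then
        jackPlancherelWeight θ n f.1 else 0) =
      ∑ f ∈ partitionSeqs n with T ≤ (f 0 : ℝ), jackPlancherelWeight θ n f := by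
    have h := tsum_subtype {f : ℕ → ℕ | Antitone f} fun f =>
      if (∑ i ∈ Finset.range n, f i) = n ∧ f n = 0 ∧ T ≤ (f 0 : ℝ) then
        jackPlancherelWeight θ n f else 0
    refine h.trans ?_
    rw [tsum_eq_sum (s := {f ∈ partitionSeqs n | T ≤ (f 0 : ℝ)})]
    · refine sum_congr rfl fun f hf => ?_
      obtain ⟨h1, h2⟩ := mem_filter.1 hf
      obtain ⟨h3, h4, h5⟩ := mem_partitionSeqs.1 h1
      rw [Set.indicator_of_mem (by exact h3), if_pos ⟨h4, h5, h2⟩]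
    · intro f hf
      by_cases h3 : Antitone f
      · rw [Set.indicator_of_mem (by exact h3), if_neg]
        rintro ⟨h4, h5, h6⟩
        exact hf (mem_filter.2 ⟨mem_partitionSeqs.2 ⟨h3, h4, h5⟩, h6⟩)
      · exact Set.indicator_of_notMem (by exact h3) _
  have hmaps : ∀ f ∈ {f ∈ partitionSeqs n | T ≤ (f 0 : ℝ)},
      f 0 ∈ (range (n + 1)).filter (fun k : ℕ => T ≤ (k : ℝ)) := by
    intro f hf
    obtain ⟨h1, h2⟩ := mem_filter.1 hf
    have h0 : 1 ≤ f 0 := by exact_mod_cast hTpos.trans_le h2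
    exact mem_filter.2 ⟨mem_range.2 (Nat.lt_succ_of_le (tail_mem_partitionSeqs h1 h0).2), h2⟩
  have hterm : ∀ k ∈ (range (n + 1)).filter (fun k : ℕ => T ≤ (k : ℝ)),
      ∑ f ∈ {f ∈ partitionSeqs n | T ≤ (f 0 : ℝ)} with f 0 = k, jackPlancherelWeight θ n f ≤
        1 / θ * Real.exp (-A₁ * T) * Real.exp (-1) ^ k := by
    intro k hk
    have hTk := (mem_filter.1 hk).2
    have hk1 : 1 ≤ k := by exact_mod_cast hTpos.trans_le hTk
    have hk0 : (0 : ℝ) < k := hTpos.trans_le hTk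
    have hfil : ({f ∈ {f ∈ partitionSeqs n | T ≤ (f 0 : ℝ)} | f 0 = k} : Finset (ℕ → ℕ)) =
        {f ∈ partitionSeqs n | f 0 = k} := by
      rw [filter_filter]
      refine filter_congr fun f _ => ⟨fun h => h.2, fun h => ⟨by rw [h]; exact hTk, h⟩⟩
    rw [hfil]
    refine (sum_weight_first_row_le hθ hk1).trans ((pow_div_prod_le hθ n hk1).trans ?_)
    have hbase : θ * Real.exp 3 * n / k ^ 2 ≤ Real.exp (-(A₁ + 1)) := by
      rw [div_le_iff₀ (by positivity)]
      have h1 : b ^ 2 * n ≤ (k : ℝ) ^ 2 := by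
        calc b ^ 2 * n ≤ u ^ 2 * n := by gcongr
          _ = T ^ 2 := by rw [hT, mul_pow, Real.sq_sqrt hn'.le]
          _ ≤ (k : ℝ) ^ 2 := by gcongr
      have h2 : Real.exp 3 = Real.exp (-(A₁ + 1)) * Real.exp (A₁ + 4) := by
        rw [← Real.exp_add]
        congr 1
        ring
      calc θ * Real.exp 3 * n = Real.exp (-(A₁ + 1)) * (b ^ 2 * n) := by rw [h2, hb2]; ring
        _ ≤ Real.exp (-(A₁ + 1)) * k ^ 2 := by gcongr
    have hpow : Real.exp (-(A₁ + 1)) ^ k = Real.exp (-A₁ * k) * Real.exp (-1) ^ k := by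
      rw [← Real.exp_nat_mul, ← Real.exp_nat_mul, ← Real.exp_add]
      congr 1
      ring
    have hexp : Real.exp (-A₁ * k) ≤ Real.exp (-A₁ * T) := by
      refine Real.exp_le_exp.2 ?_
      have := mul_le_mul_of_nonneg_left hTk hA₁.le
      linarith
    calc 1 / θ * (θ * Real.exp 3 * n / k ^ 2) ^ k ≤ 1 / θ * Real.exp (-(A₁ + 1)) ^ k := by gcongr
      _ = 1 / θ * Real.exp (-A₁ * k) * Real.exp (-1) ^ k := by rw [hpow, mul_assoc]
      _ ≤ 1 / θ * Real.exp (-A₁ * T) * Real.exp (-1) ^ k := by gcongr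
  have hgeom : ∑ k ∈ (range (n + 1)).filter (fun k : ℕ => T ≤ (k : ℝ)), Real.exp (-1) ^ k ≤ C := by
    rw [hC, ← tsum_geometric_of_lt_one (Real.exp_pos _).le he]
    exact (summable_geometric_of_lt_one (Real.exp_pos _).le he).sum_le_tsum _
      fun _ _ => by positivity
  rw [hsum, ← sum_fiberwise_of_maps_to hmaps]
  refine (sum_le_sum hterm).trans ?_
  rw [← mul_sum, mul_assoc (-A₁), ← hT]
  calc 1 / θ * Real.exp (-A₁ * T) *
        ∑ k ∈ (range (n + 1)).filter (fun k : ℕ => T ≤ (k : ℝ)), Real.exp (-1) ^ k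
      ≤ 1 / θ * Real.exp (-A₁ * T) * C := by gcongr
    _ = 1 / θ * C * Real.exp (-A₁ * T) := by ring
end
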